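/- arXiv:1908.02731 — 7 statements merged into one kernel-verified Lean document; each statement's English description precedes it below -/
import Mathlib

section
/- Let C be a permutation class and suppose there exist proper subclasses A₁, …, A_k ⊊ C with C ⊆ A₁ ⊙ ⋯ ⊙ A_k. Then there exist two proper subclasses A, B ⊊ C such that C ⊆ A ⊙ B. -/
/-- A permutation of some finite length `n`, bundled with its length. -/
abbrev PermOn : Type := Σ n : ℕ, Equiv.Perm (Fin n)

/-- Pattern containment: `PattLe σ π` means the permutation `π` contains the
pattern `σ`, i.e. there are positions `f u` (strictly increasing in `u`)
whose values in `π` are order isomorphic to `σ`. -/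
def PattLe (σ π : PermOn) : Prop :=
  ∃ f : Fin σ.1 ↪o Fin π.1, ∀ u v : Fin σ.1, σ.2 u < σ.2 v ↔ π.2 (f u) < π.2 (f v)

/-- A permutation class: a set of permutations closed downward under
pattern containment. -/
def IsPermClass (C : Set PermOn) : Prop :=
  ∀ π ∈ C, ∀ σ : PermOn, PattLe σ π → σ ∈ C

/-- The class `C` avoids the permutation `τ`: no element of `C` contains `τ`. -/
def ClassAvoids (C : Set PermOn) (τ : PermOn) : Prop :=
  ∀ σ ∈ C, ¬ PattLe τ σ

/-- `IsMerge σ α β`: the entries of `σ` can be colored red/blue so that the red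
subsequence is order isomorphic to `α` and the blue one to `β`.  The red
positions are the range of `f`, the blue positions the range of `g`. -/
def IsMerge (σ α β : PermOn) : Prop :=
  ∃ (f : Fin α.1 ↪o Fin σ.1) (g : Fin β.1 ↪o Fin σ.1),
    (∀ u v, f u ≠ g v) ∧
    (∀ i : Fin σ.1, (∃ u, f u = i) ∨ (∃ v, g v = i)) ∧
    (∀ u v, α.2 u < α.2 v ↔ σ.2 (f u) < σ.2 (f v)) ∧
    (∀ u v, β.2 u < β.2 v ↔ σ.2 (g u) < σ.2 (g v))

/-- The merge `A ⊙ B` of two classes. -/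
def MergeClass (A B : Set PermOn) : Set PermOn :=
  { σ | ∃ α ∈ A, ∃ β ∈ B, IsMerge σ α β }

/-- The class consisting only of the empty permutation; it is a two-sided
identity for merging, used as base case for iterated merges. -/
def EmptyPermClass : Set PermOn := { σ | σ.1 = 0 }

/-- Iterated merge `A₁ ⊙ A₂ ⊙ ⋯ ⊙ A_k` of a list of classes. -/
def MergeAll (l : List (Set PermOn)) : Set PermOn :=
  l.foldr MergeClass EmptyPermClass

/-- A class is splittable if it is contained in the merge of finitely many
(at least one) proper subclasses. -/
def Splittable (C : Set PermOn) : Prop :=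
  ∃ As : List (Set PermOn), As ≠ [] ∧ (∀ A ∈ As, IsPermClass A ∧ A ⊂ C) ∧
    C ⊆ MergeAll As

/-- The increasing permutation `ι_n = 1 2 ⋯ n`. -/
def iota (n : ℕ) : PermOn := ⟨n, 1⟩

/-- The decreasing permutation `δ_n = n (n-1) ⋯ 1`. -/
def delta (n : ℕ) : PermOn := ⟨n, Fin.revPerm⟩

/-- The class `I` of all increasing permutations. -/
def Iclass : Set PermOn := Set.range iota

/-- The class `D` of all decreasing permutations. -/
def Dclass : Set PermOn := Set.range delta

/-- The class `I_m` of all permutations avoiding `δ_{m+1}`. -/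
def Im (m : ℕ) : Set PermOn := { σ | ¬ PattLe (delta (m + 1)) σ }

/-- The class `D_m` of all permutations avoiding `ι_{m+1}`. -/
def Dm (m : ℕ) : Set PermOn := { σ | ¬ PattLe (iota (m + 1)) σ }

/-- The composition `A ∘ B` of two classes: all `α ∘ β` with `α ∈ A`, `β ∈ B`
of the same length, where `(α ∘ β) i = α (β i)`. -/
def CompClass (A B : Set PermOn) : Set PermOn :=
  { σ | ∃ (n : ℕ) (α β : Equiv.Perm (Fin n)),
      (⟨n, α⟩ : PermOn) ∈ A ∧ (⟨n, β⟩ : PermOn) ∈ B ∧ σ = ⟨n, α * β⟩ }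

/-- The class of all identity permutations; a two-sided identity for
composition of classes, used as base case for iterated compositions. -/
def IdPermClass : Set PermOn := { σ | σ.2 = 1 }

/-- Iterated composition `A₁ ∘ A₂ ∘ ⋯ ∘ A_k` of a list of classes. -/
def CompAll (l : List (Set PermOn)) : Set PermOn :=
  l.foldr CompClass IdPermClass

/-- A class is composable if it is contained in the composition of finitely
many (at least one) proper subclasses. -/
def Composable (C : Set PermOn) : Prop :=
  ∃ As : List (Set PermOn), As ≠ [] ∧ (∀ A ∈ As, IsPermClass A ∧ A ⊂ C) ∧
    C ⊆ CompAll As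

/-- `IsInflation τ π σs`: `τ` is the inflation `π[σs 0, …, σs (n-1)]`.
The bijection `b` sends the `j`-th entry of the `i`-th block to its position in
`τ`; blocks occupy consecutive positions ordered as in `π`'s positions, within
a block positions are ordered as in `σs i`, values of distinct blocks compare
as the corresponding values of `π`, and values within a block compare as in
`σs i`. -/
def IsInflation (τ π : PermOn) (σs : Fin π.1 → PermOn) : Prop :=
  ∃ b : (Σ i : Fin π.1, Fin (σs i).1) ≃ Fin τ.1,
    (∀ (i i' : Fin π.1) (j : Fin (σs i).1) (j' : Fin (σs i').1),
        i < i' → b ⟨i, j⟩ < b ⟨i', j'⟩) ∧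
    (∀ (i : Fin π.1) (j j' : Fin (σs i).1), b ⟨i, j⟩ < b ⟨i, j'⟩ ↔ j < j') ∧
    (∀ (i i' : Fin π.1) (j : Fin (σs i).1) (j' : Fin (σs i').1), i ≠ i' →
        (τ.2 (b ⟨i, j⟩) < τ.2 (b ⟨i', j'⟩) ↔ π.2 i < π.2 i')) ∧
    (∀ (i : Fin π.1) (j j' : Fin (σs i).1),
        τ.2 (b ⟨i, j⟩) < τ.2 (b ⟨i, j'⟩) ↔ (σs i).2 j < (σs i).2 j')

/-- The inflation `A[B]` of the class `A` by the class `B`: all inflations of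
an element of `A` by (nonempty) elements of `B`. -/
def InflClass (A B : Set PermOn) : Set PermOn :=
  { τ | ∃ π ∈ A, ∃ σs : Fin π.1 → PermOn,
      (∀ i, σs i ∈ B ∧ 0 < (σs i).1) ∧ IsInflation τ π σs }

/-- The direct sum `α ⊕ β` of two permutations. -/
def dsum (α β : PermOn) : PermOn :=
  ⟨α.1 + β.1, finSumFinEquiv.symm.trans ((α.2.sumCongr β.2).trans finSumFinEquiv)⟩

/-- Iterated direct sum `π₁ ⊕ π₂ ⊕ ⋯ ⊕ π_n` of a list of permutations. -/
def bigDsum : List PermOn → PermOn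
  | [] => ⟨0, 1⟩
  | p :: l => dsum p (bigDsum l)

/-- The reversal `π^r` of a permutation `π`. -/
def revP (p : PermOn) : PermOn := ⟨p.1, p.2 * Fin.revPerm⟩

/-- Composition of two bundled permutations of the same length,
`(pcomp a b) i = a (b i)`; if the lengths differ it defaults to `a`. -/
def pcomp (a b : PermOn) : PermOn :=
  if h : b.1 = a.1 then ⟨a.1, a.2 * (finCongr h).permCongr b.2⟩ else a

theorem exists_pattern_of_finset (π : PermOn) (S : Finset (Fin π.1)) :
    ∃ (σ : PermOn) (f : Fin σ.1 ↪o Fin π.1), (∀ i, (∃ u, f u = i) ↔ i ∈ S) ∧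
      ∀ u v, σ.2 u < σ.2 v ↔ π.2 (f u) < π.2 (f v) := by
  have hT : (S.map π.2.toEmbedding).card = S.card := Finset.card_map _
  let e : S ≃ (S.map π.2.toEmbedding : Finset (Fin π.1)) :=
    π.2.subtypeEquiv (fun a => by simp)
  refine ⟨⟨S.card, ((S.orderIsoOfFin rfl).toEquiv.trans e).trans
    ((S.map π.2.toEmbedding).orderIsoOfFin hT).symm.toEquiv⟩, S.orderEmbOfFin rfl, ?_, ?_⟩
  · intro i
    rw [← Set.mem_range, Finset.range_orderEmbOfFin, Finset.mem_coe]
  · intro u v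
    exact ((S.map π.2.toEmbedding).orderIsoOfFin hT).symm.lt_iff_lt

theorem OrderEmbedding.exists_factor {α β γ : Type*} [Preorder α] [Preorder β] [Preorder γ]
    (f : α ↪o γ) (k : β ↪o γ) (h : ∀ x, ∃ u, f u = k x) :
    ∃ l : β ↪o α, ∀ x, f (l x) = k x := by
  choose l hl using h
  refine ⟨⟨⟨l, fun x y hxy => k.injective ?_⟩, fun {x y} => ?_⟩, hl⟩
  · rw [← hl x, ← hl y, hxy]
  · change l x ≤ l y ↔ x ≤ y
    rw [← f.le_iff_le, hl, hl, k.le_iff_le]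

theorem PattLe.of_range_subset {σ τ α α' : PermOn} (h : Fin τ.1 ↪o Fin σ.1)
    (hh : ∀ u v, τ.2 u < τ.2 v ↔ σ.2 (h u) < σ.2 (h v))
    (f : Fin α.1 ↪o Fin σ.1) (hf : ∀ u v, α.2 u < α.2 v ↔ σ.2 (f u) < σ.2 (f v))
    (k : Fin α'.1 ↪o Fin τ.1) (hk : ∀ u v, α'.2 u < α'.2 v ↔ τ.2 (k u) < τ.2 (k v))
    (hr : ∀ x, ∃ u, f u = h (k x)) : PattLe α' α := by
  obtain ⟨l, hl⟩ := OrderEmbedding.exists_factor f (k.trans h) hr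
  refine ⟨l, fun u v => ?_⟩
  rw [hk, hh, hf, hl, hl]
  rfl

theorem IsPermClass.mergeClass {A B : Set PermOn} (hA : IsPermClass A) (hB : IsPermClass B) :
    IsPermClass (MergeClass A B) := by
  classical
  rintro σ ⟨α, hα, β, hβ, f, g, hfg, hcov, hf, hg⟩ τ ⟨h, hh⟩
  obtain ⟨α', k, hkS, hk⟩ :=
    exists_pattern_of_finset τ (Finset.univ.filter fun i => ∃ u, f u = h i)
  obtain ⟨β', m, hmS, hm⟩ :=
    exists_pattern_of_finset τ (Finset.univ.filter fun i => ∃ v, g v = h i)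
  simp only [Finset.mem_filter, Finset.mem_univ, true_and] at hkS hmS
  have hkr : ∀ x, ∃ u, f u = h (k x) := fun x => (hkS _).1 ⟨x, rfl⟩
  have hmr : ∀ x, ∃ v, g v = h (m x) := fun x => (hmS _).1 ⟨x, rfl⟩
  refine ⟨α', hA α hα _ (.of_range_subset h hh f hf k hk hkr),
    β', hB β hβ _ (.of_range_subset h hh g hg m hm hmr), k, m, ?_, ?_, hk, hm⟩
  · intro x y hxy
    obtain ⟨u, hu⟩ := hkr x
    obtain ⟨v, hv⟩ := hmr y
    exact hfg u v (by rw [hu, hv, hxy])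
  · intro i
    rw [hkS, hmS]
    exact hcov (h i)

theorem isPermClass_emptyPermClass : IsPermClass EmptyPermClass := by
  rintro π hπ σ ⟨f, -⟩
  have := Fintype.card_le_of_injective f f.injective
  simp only [Fintype.card_fin] at this
  exact Nat.le_zero.1 (this.trans_eq hπ)

theorem isPermClass_mergeAll (l : List (Set PermOn)) (hl : ∀ A ∈ l, IsPermClass A) :
    IsPermClass (MergeAll l) := by
  induction l with
  | nil => exact isPermClass_emptyPermClass
  | cons A l ih =>
    exact (hl A (by simp)).mergeClass (ih fun B hB => hl B (by simp [hB]))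

theorem IsPermClass.inter {A B : Set PermOn} (hA : IsPermClass A) (hB : IsPermClass B) :
    IsPermClass (A ∩ B) :=
  fun π hπ σ hσ => ⟨hA π hπ.1 σ hσ, hB π hπ.2 σ hσ⟩

theorem eq_of_mem_emptyPermClass {σ τ : PermOn} (hσ : σ ∈ EmptyPermClass)
    (hτ : τ ∈ EmptyPermClass) : σ = τ := by
  obtain ⟨n, p⟩ := σ
  obtain ⟨m, q⟩ := τ
  obtain rfl : n = 0 := hσ
  obtain rfl : m = 0 := hτ
  rw [Subsingleton.elim p q]

/-- If a permutation class `C` is contained in the merge of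
finitely many proper subclasses, then it is contained in the merge of just
two proper subclasses. -/
theorem stmt_0 (C : Set PermOn) (hC : IsPermClass C)
    (As : List (Set PermOn)) (hne : As ≠ [])
    (hsub : ∀ A ∈ As, IsPermClass A ∧ A ⊂ C)
    (hmerge : C ⊆ MergeAll As) :
    ∃ A B : Set PermOn, IsPermClass A ∧ IsPermClass B ∧ A ⊂ C ∧ B ⊂ C ∧
      C ⊆ MergeClass A B := by
  induction As with
  | nil => exact absurd rfl hne
  | cons A l ih =>
    obtain ⟨hA, hAC⟩ := hsub A (by simp)
    have hl : ∀ B ∈ l, IsPermClass B ∧ B ⊂ C := fun B hB => hsub B (by simp [hB])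
    by_cases hCl : C ⊆ MergeAll l
    · refine ih ?_ hl hCl
      rintro rfl
      obtain ⟨c, hc, hcA⟩ := Set.exists_of_ssubset hAC
      obtain ⟨α, hα, -⟩ := hmerge hc
      exact hcA (eq_of_mem_emptyPermClass (hCl (hAC.1 hα)) (hCl hc) ▸ hα)
    · refine ⟨A, C ∩ MergeAll l, hA, hC.inter (isPermClass_mergeAll l fun B hB => (hl B hB).1),
        hAC, ⟨Set.inter_subset_left, fun h => hCl fun c hc => (h hc).2⟩, fun σ hσ => ?_⟩
      obtain ⟨α, hα, β, hβ, hm⟩ := hmerge hσ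
      obtain ⟨f, g, -, -, -, hg⟩ := id hm
      exact ⟨α, hα, β, ⟨hC σ hσ β ⟨g, hg⟩, hβ⟩, hm⟩
end

section
/- If permutation classes A and B are both unsplittable, then the inflation class A[B] is also unsplittable. -/
/-- `f` is an occurrence of the pattern `σ` in `π`. -/
def IsOcc (σ π : PermOn) (f : Fin σ.1 ↪o Fin π.1) : Prop :=
  ∀ u v : Fin σ.1, σ.2 u < σ.2 v ↔ π.2 (f u) < π.2 (f v)

/-- The pattern `σ` occurs in `π` using only positions from `S`. -/
def OccursIn (σ π : PermOn) (S : Set (Fin π.1)) : Prop :=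
  ∃ f : Fin σ.1 ↪o Fin π.1, (∀ u, f u ∈ S) ∧ IsOcc σ π f

theorem OccursIn.pattLe {σ π : PermOn} {S : Set (Fin π.1)} (h : OccursIn σ π S) :
    PattLe σ π := by
  obtain ⟨f, -, hf⟩ := h
  exact ⟨f, hf⟩

theorem OccursIn.of_pattLe {ρ σ π : PermOn} {S : Set (Fin π.1)} (h : PattLe ρ σ)
    (h' : OccursIn σ π S) : OccursIn ρ π S := by
  obtain ⟨f, hf⟩ := h
  obtain ⟨g, hgS, hg⟩ := h'
  exact ⟨f.trans g, fun u => hgS _, fun u v => (hf u v).trans (hg _ _)⟩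

theorem OccursIn.map {ρ σ π : PermOn} {S : Set (Fin σ.1)} {T : Set (Fin π.1)}
    {g : Fin σ.1 ↪o Fin π.1} (hg : IsOcc σ π g) (hST : ∀ u ∈ S, g u ∈ T)
    (h : OccursIn ρ σ S) : OccursIn ρ π T := by
  obtain ⟨f, hfS, hf⟩ := h
  exact ⟨f.trans g, fun u => hST _ (hfS u), fun u v => (hf u v).trans (hg _ _)⟩

/-- An occurrence of `ρ` inside the range of an occurrence of `σ` factors through it. -/
theorem OccursIn.comap {ρ σ π : PermOn} {S : Set (Fin σ.1)} {T : Set (Fin π.1)}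
    {g : Fin σ.1 ↪o Fin π.1} (hg : IsOcc σ π g) (hT : ∀ i ∈ T, ∃ u ∈ S, g u = i)
    (h : OccursIn ρ π T) : OccursIn ρ σ S := by
  obtain ⟨f, hfT, hf⟩ := h
  choose k hkS hk using fun u => hT (f u) (hfT u)
  refine ⟨OrderEmbedding.ofMapLEIff k fun u v => ?_, hkS, fun u v => ?_⟩
  · rw [← g.le_iff_le, hk, hk, f.le_iff_le]
  · rw [hf, ← hk, ← hk]
    exact (hg _ _).symm

/-- A finite linear order with an injective labelling by a linear order is
order isomorphic to a permutation. -/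
theorem exists_permOn_of_injective {X V : Type*} [LinearOrder X] [Finite X] [LinearOrder V]
    (v : X → V) (hv : Function.Injective v) :
    ∃ (p : PermOn) (e : X ≃o Fin p.1), ∀ x y, p.2 (e x) < p.2 (e y) ↔ v x < v y := by
  have := Fintype.ofFinite X
  have : Fintype (Set.range v) := Fintype.ofFinite _
  let e := (Fintype.orderIsoFinOfCardEq X rfl).symm
  let w := (Fintype.orderIsoFinOfCardEq (Set.range v)
    (Fintype.card_congr (Equiv.ofInjective v hv)).symm).symm
  refine ⟨⟨_, e.symm.toEquiv.trans ((Equiv.ofInjective v hv).trans w.toEquiv)⟩, e,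
    fun x y => ?_⟩
  simp [← Subtype.coe_lt_coe]

/-- Every set of positions of `π` carries a pattern. -/
theorem exists_isOcc_range (π : PermOn) (S : Set (Fin π.1)) :
    ∃ (σ : PermOn) (f : Fin σ.1 ↪o Fin π.1), IsOcc σ π f ∧ Set.range f = S := by
  obtain ⟨p, e, hp⟩ := exists_permOn_of_injective (fun x : S => π.2 x)
    (π.2.injective.comp Subtype.val_injective)
  refine ⟨p, e.symm.toOrderEmbedding.trans (OrderEmbedding.subtype S), fun u v => ?_, ?_⟩
  · have h := hp (e.symm u) (e.symm v)
    rwa [e.apply_symm_apply, e.apply_symm_apply] at h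
  · ext i
    constructor
    · rintro ⟨u, rfl⟩
      exact (e.symm u).2
    · intro hi
      exact ⟨e ⟨i, hi⟩, congrArg Subtype.val (e.symm_apply_apply _)⟩

/-- A permutation lies in an iterated merge as soon as its entries can be coloured
so that the patterns of each colour lie in the corresponding class. -/
theorem mem_mergeAll_of_coloring (l : List (Set PermOn)) (π : PermOn) (c : Fin π.1 → ℕ)
    (hlt : ∀ x, c x < l.length)
    (hc : ∀ j A, l[j]? = some A → ∀ σ, OccursIn σ π {x | c x = j} → σ ∈ A) :
    π ∈ MergeAll l := by
  induction l generalizing π with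
  | nil =>
    by_contra h
    exact absurd (hlt ⟨0, Nat.pos_of_ne_zero h⟩) (by simp)
  | cons A l ih =>
    obtain ⟨α, f, hf, hfr⟩ := exists_isOcc_range π {x | c x = 0}
    obtain ⟨β, g, hg, hgr⟩ := exists_isOcc_range π {x | c x ≠ 0}
    have hf0 : ∀ u, c (f u) = 0 := fun u => hfr.subset ⟨u, rfl⟩
    have hg0 : ∀ v, c (g v) ≠ 0 := fun v => hgr.subset ⟨v, rfl⟩
    refine ⟨α, hc 0 A rfl α ⟨f, hf0, hf⟩, β, ih β (fun v => c (g v) - 1) ?_ ?_,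
      f, g, ?_, ?_, hf, hg⟩
    · intro v
      have h1 := hlt (g v)
      have h2 := hg0 v
      simp only [List.length_cons] at h1
      omega
    · intro j B hj σ hσ
      refine hc (j + 1) B (by simpa using hj) σ (hσ.map hg fun v hv => ?_)
      have h2 := hg0 v
      simp only [Set.mem_ofPred_eq] at hv ⊢
      omega
    · intro u v h
      exact hg0 v (h ▸ hf0 u)
    · intro i
      by_cases h : c i = 0
      · exact Or.inl (hfr.superset h)
      · exact Or.inr (hgr.superset h)

/-- The members of an iterated merge of classes have colourings for which the patterns
of each colour lie in the corresponding class. -/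
theorem exists_coloring_of_mem_mergeAll (l : List (Set PermOn)) (hl : ∀ A ∈ l, IsPermClass A)
    (π : PermOn) (hπ : π ∈ MergeAll l) :
    ∃ c : Fin π.1 → ℕ, (∀ x, c x < l.length) ∧
      ∀ j A, l[j]? = some A → ∀ σ, OccursIn σ π {x | c x = j} → σ ∈ A := by
  induction l generalizing π with
  | nil =>
    have h0 : π.1 = 0 := hπ
    exact ⟨fun _ => 0, fun x => absurd x.2 (by omega), by simp⟩
  | cons A l ih =>
    obtain ⟨α, hα, β, hβ, f, g, hfg, hcov, hf, hg⟩ := hπ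
    obtain ⟨c, hlt, hc⟩ := ih (fun B hB => hl B (List.mem_cons_of_mem _ hB)) β hβ
    have hext : ∃ d : Fin π.1 → ℕ, (∀ u, d (f u) = 0) ∧ ∀ v, d (g v) = c v + 1 := by
      refine ⟨Function.extend g (fun v => c v + 1) fun _ => 0, fun u => ?_, fun v => ?_⟩
      · exact Function.extend_apply' _ _ _ fun ⟨v, hv⟩ => hfg u v hv.symm
      · exact g.injective.extend_apply _ _ _
    obtain ⟨d, hdf, hdg⟩ := hext
    refine ⟨d, fun x => ?_, fun j B hj σ hσ => ?_⟩
    · obtain ⟨u, rfl⟩ | ⟨v, rfl⟩ := hcov x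
      · simp [hdf]
      · simpa [hdg] using hlt v
    · cases j with
      | zero =>
        obtain rfl : A = B := by simpa using hj
        refine hl A List.mem_cons_self α hα σ (OccursIn.pattLe (S := Set.univ) ?_)
        refine hσ.comap hf fun i hi => ?_
        obtain ⟨u, rfl⟩ | ⟨v, rfl⟩ := hcov i
        · exact ⟨u, trivial, rfl⟩
        · simp [hdg] at hi
      | succ j =>
        refine hc j B (by simpa using hj) σ (hσ.comap hg fun i hi => ?_)
        obtain ⟨u, rfl⟩ | ⟨v, rfl⟩ := hcov i
        · simp [hdf] at hi
        · exact ⟨v, by simpa [hdg] using hi, rfl⟩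

/-- Ramsey property of an unsplittable class: prescribed patterns, one for each colour,
are unavoidable in the colourings of some member of the class. -/
theorem exists_forall_coloring_occursIn {C : Set PermOn} (hC : IsPermClass C)
    (hu : ¬ Splittable C) (l : List PermOn) (hne : l ≠ []) (hl : ∀ σ ∈ l, σ ∈ C) :
    ∃ π ∈ C, ∀ c : Fin π.1 → ℕ, (∀ x, c x < l.length) →
      ∃ j σ, l[j]? = some σ ∧ OccursIn σ π {x | c x = j} := by
  by_contra! hcon
  refine hu ⟨l.map fun σ => {ρ | ρ ∈ C ∧ ¬ PattLe σ ρ}, by simpa using hne, ?_, ?_⟩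
  · intro A hA
    obtain ⟨σ, hσ, rfl⟩ := List.mem_map.1 hA
    refine ⟨fun ρ hρ κ hκ => ⟨hC ρ hρ.1 κ hκ, fun h => hρ.2 ?_⟩, fun ρ hρ => hρ.1, fun h => ?_⟩
    · obtain ⟨f, hf⟩ := h
      obtain ⟨g, hg⟩ := hκ
      exact ⟨f.trans g, fun u v => (hf u v).trans (hg _ _)⟩
    · exact (h (hl σ hσ)).2 ⟨RelEmbedding.refl _, fun u v => Iff.rfl⟩
  · intro π hπ
    obtain ⟨c, hlt, hc⟩ := hcon π hπ
    refine mem_mergeAll_of_coloring _ π c (by simpa using hlt) fun j A hj ρ hρ => ?_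
    rw [List.getElem?_map, Option.map_eq_some_iff] at hj
    obtain ⟨σ, hσ, rfl⟩ := hj
    exact ⟨hC π hπ ρ hρ.pattLe, fun h => hc j σ hσ (hρ.of_pattLe h)⟩

/-- Every colouring of some member of an unsplittable class contains a prescribed member
monochromatically. -/
theorem exists_forall_coloring_mono {C : Set PermOn} (hC : IsPermClass C)
    (hu : ¬ Splittable C) {σ : PermOn} (hσ : σ ∈ C) {k : ℕ} (hk : 0 < k) :
    ∃ π ∈ C, ∀ c : Fin π.1 → ℕ, (∀ x, c x < k) → ∃ j < k, OccursIn σ π {x | c x = j} := by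
  obtain ⟨π, hπ, h⟩ := exists_forall_coloring_occursIn hC hu (List.replicate k σ)
    (by simpa using hk.ne') fun ρ hρ => List.eq_of_mem_replicate hρ ▸ hσ
  refine ⟨π, hπ, fun c hc => ?_⟩
  obtain ⟨j, ρ, hj, hρ⟩ := h c (by simpa using hc)
  obtain ⟨hjk, rfl⟩ : j < k ∧ σ = ρ := by simpa [List.getElem?_replicate] using hj
  exact ⟨j, hjk, hρ⟩

/-- Finitely many nonempty members of an unsplittable class are jointly contained in a member. -/
theorem exists_forall_pattLe {C : Set PermOn} (hC : IsPermClass C) (hu : ¬ Splittable C)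
    {S : Set PermOn} (hfin : S.Finite) (hne : S.Nonempty) (hS : S ⊆ C)
    (hpos : ∀ σ ∈ S, 0 < σ.1) :
    ∃ π ∈ C, ∀ σ ∈ S, PattLe σ π := by
  obtain ⟨l, hl⟩ : ∃ l : List PermOn, ∀ σ, σ ∈ l ↔ σ ∈ S :=
    ⟨hfin.toFinset.toList, by simp⟩
  obtain ⟨σ₀, h₀⟩ := hne
  obtain ⟨π, hπ, h⟩ := exists_forall_coloring_occursIn hC hu l
    (List.ne_nil_of_mem ((hl σ₀).2 h₀)) fun σ hσ => hS ((hl σ).1 hσ)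
  refine ⟨π, hπ, fun σ hσ => ?_⟩
  obtain ⟨i, hi, rfl⟩ := List.mem_iff_getElem.1 ((hl σ).2 hσ)
  obtain ⟨j, ρ, hj, hρ⟩ := h (fun _ => i) fun _ => hi
  by_cases hij : i = j
  · subst hij
    rw [List.getElem?_eq_getElem hi, Option.some_inj] at hj
    exact hj ▸ hρ.pattLe
  · obtain ⟨f, hf, -⟩ := hρ
    exact absurd (hf ⟨0, hpos ρ ((hl ρ).1 (List.mem_of_getElem? hj))⟩) hij

/-- There is an inflation of `α` with all blocks equal to `β`, whose positions are the
lexicographically ordered pairs of positions of `α` and `β`. -/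
theorem exists_inflation_const (α β : PermOn) :
    ∃ (τ : PermOn) (e : Fin α.1 ×ₗ Fin β.1 ≃o Fin τ.1),
      (∀ x y, τ.2 (e (toLex x)) < τ.2 (e (toLex y)) ↔
        toLex (α.2 x.1, β.2 x.2) < toLex (α.2 y.1, β.2 y.2)) ∧
      IsInflation τ α fun _ => β := by
  obtain ⟨p, e, hp⟩ := exists_permOn_of_injective
    (fun x : Fin α.1 ×ₗ Fin β.1 => toLex (α.2 (ofLex x).1, β.2 (ofLex x).2)) (by
      intro x y h
      have h' := toLex.injective h
      simp only [Prod.mk.injEq, EmbeddingLike.apply_eq_iff_eq] at h'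
      exact ofLex.injective (Prod.ext h'.1 h'.2))
  refine ⟨p, e, fun x y => hp _ _,
    (Equiv.sigmaEquivProd _ _).trans (toLex.trans e.toEquiv), ?_, ?_, ?_, ?_⟩
  · intro i i' j j' h
    simp [Prod.Lex.toLex_lt_toLex, h]
  · intro i j j'
    simp [Prod.Lex.toLex_lt_toLex]
  · intro i i' j j' h
    simp [hp, Prod.Lex.toLex_lt_toLex, h]
  · intro i j j'
    simp [hp, Prod.Lex.toLex_lt_toLex]

/-- Occurrences of the quotient and of the blocks of an inflation assemble to an occurrence
of the inflation. -/
theorem IsInflation.occursIn {τ π α β κ : PermOn} {σs : Fin π.1 → PermOn}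
    (h : IsInflation τ π σs) (e : Fin α.1 ×ₗ Fin β.1 ≃o Fin κ.1)
    (he : ∀ x y, κ.2 (e (toLex x)) < κ.2 (e (toLex y)) ↔
      toLex (α.2 x.1, β.2 x.2) < toLex (α.2 y.1, β.2 y.2))
    {F : Fin π.1 ↪o Fin α.1} (hF : IsOcc π α F)
    {G : ∀ i, Fin (σs i).1 ↪o Fin β.1} (hG : ∀ i, IsOcc (σs i) β (G i))
    {S : Set (Fin κ.1)} (hS : ∀ i j, e (toLex (F i, G i j)) ∈ S) : OccursIn τ κ S := by
  obtain ⟨b, hb, hb', hv, hv'⟩ := h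
  let f : Fin τ.1 → Fin κ.1 := fun x => e (toLex (F (b.symm x).1, G _ (b.symm x).2))
  have hf : ∀ i j, f (b ⟨i, j⟩) = e (toLex (F i, G i j)) := fun i j => by
    simp only [f]
    rw [b.symm_apply_apply]
  have hmono : StrictMono f := by
    intro x y hxy
    obtain ⟨⟨i, j⟩, rfl⟩ := b.surjective x
    obtain ⟨⟨i', j'⟩, rfl⟩ := b.surjective y
    rw [hf, hf, e.lt_iff_lt, Prod.Lex.toLex_lt_toLex]
    obtain hlt | rfl | hlt := lt_trichotomy i i'
    · exact Or.inl (F.lt_iff_lt.2 hlt)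
    · exact Or.inr ⟨rfl, (G i).lt_iff_lt.2 ((hb' _ _ _).1 hxy)⟩
    · exact absurd hxy (hb _ _ _ _ hlt).not_gt
  refine ⟨OrderEmbedding.ofStrictMono f hmono, fun x => hS _ _, fun x y => ?_⟩
  obtain ⟨⟨i, j⟩, rfl⟩ := b.surjective x
  obtain ⟨⟨i', j'⟩, rfl⟩ := b.surjective y
  simp only [OrderEmbedding.coe_ofStrictMono, hf, he, Prod.Lex.toLex_lt_toLex]
  by_cases hi : i = i'
  · subst hi
    simpa [hv'] using hG i j j'
  · simpa [hv i i' j j' hi, hi] using hF i i'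

/-- If the permutation classes `A` and `B` are unsplittable, then
the inflation class `A[B]` is unsplittable. -/
theorem stmt_3 (A B : Set PermOn) (hA : IsPermClass A) (hB : IsPermClass B)
    (huA : ¬ Splittable A) (huB : ¬ Splittable B) :
    ¬ Splittable (InflClass A B) := by
  rintro ⟨As, hne, hAs, hsub⟩
  have hk : 0 < As.length := List.length_pos_iff.2 hne
  have hcol := fun τ hτ =>
    exists_coloring_of_mem_mergeAll As (fun C hC => (hAs C hC).1) τ (hsub hτ)
  have hex : ∀ j : Fin As.length, ∃ τ ∈ InflClass A B, τ ∉ As[j] := fun j =>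
    Set.exists_of_ssubset (hAs _ (List.getElem_mem j.2)).2
  choose τ hτ hτn using hex
  have hτpos : ∀ j, 0 < (τ j).1 := by
    intro j
    by_contra h0
    obtain ⟨c, -, hc⟩ := hcol _ (hτ j)
    refine hτn j (hc j _ (List.getElem?_eq_getElem j.2) _ ?_)
    have hempty : IsEmpty (Fin (τ j).1) := ⟨fun x => h0 x.pos⟩
    exact ⟨RelEmbedding.refl _, fun u => isEmptyElim u, fun u v => Iff.rfl⟩
  choose α hα σs hσs hinfl using hτ
  have hblock : ∀ j, 0 < (α j).1 := by
    intro j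
    obtain ⟨b, -⟩ := hinfl j
    exact (b.symm ⟨0, hτpos j⟩).1.pos
  let j₀ : Fin As.length := ⟨0, hk⟩
  obtain ⟨α₁, hα₁, hle₁⟩ := exists_forall_pattLe hA huA (Set.finite_range α)
    ⟨_, j₀, rfl⟩ (by rintro _ ⟨j, rfl⟩; exact hα j) (by rintro _ ⟨j, rfl⟩; exact hblock j)
  obtain ⟨β₁, hβ₁, hle₂⟩ := exists_forall_pattLe hB huB
    (Set.finite_range fun x : Σ j, Fin (α j).1 => σs x.1 x.2)
    ⟨_, ⟨j₀, 0, hblock j₀⟩, rfl⟩ (by rintro _ ⟨x, rfl⟩; exact (hσs x.1 x.2).1)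
    (by rintro _ ⟨x, rfl⟩; exact (hσs x.1 x.2).2)
  obtain ⟨α₂, hα₂, hmono₁⟩ := exists_forall_coloring_mono hA huA hα₁ hk
  obtain ⟨β₂, hβ₂, hmono₂⟩ := exists_forall_coloring_mono hB huB hβ₁ hk
  obtain ⟨κ, e, he, hκ⟩ := exists_inflation_const α₂ β₂
  have hβ₂pos : 0 < β₂.1 := by
    obtain ⟨f, -⟩ := hle₂ _ ⟨⟨j₀, 0, hblock j₀⟩, rfl⟩
    obtain ⟨-, -, g, -⟩ := hmono₂ (fun _ => 0) fun _ => hk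
    exact (g (f ⟨0, (hσs _ _).2⟩)).pos
  obtain ⟨c, hlt, hc⟩ := hcol κ ⟨α₂, hα₂, _, fun _ => ⟨hβ₂, hβ₂pos⟩, hκ⟩
  choose d hd hocc using fun a => hmono₂ (fun y => c (e (toLex (a, y)))) fun _ => hlt _
  obtain ⟨j, hj, hF⟩ := hmono₁ d hd
  obtain ⟨F, hFc, hF⟩ := hF.of_pattLe (hle₁ _ ⟨⟨j, hj⟩, rfl⟩)
  choose G hGc hG using fun i => (hocc (F i)).of_pattLe (hle₂ _ ⟨⟨⟨j, hj⟩, i⟩, rfl⟩)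
  refine hτn ⟨j, hj⟩ (hc j _ (List.getElem?_eq_getElem hj) _
    ((hinfl ⟨j, hj⟩).occursIn e he hF hG fun i u => ?_))
  exact (hGc i u).trans (hFc i)
end

section
/- The permutation class C = I[D[I]] is composable but unsplittable. That is, there exist proper subclasses A₁,…,A_k ⊊ C with C ⊆ A₁ ∘ ⋯ ∘ A_k, but there do not exist proper subclasses B₁,…,B_m ⊊ C with C ⊆ B₁ ⊙ ⋯ ⊙ B_m. -/
/-- A permutation is determined by the relative order of its values. -/
theorem perm_eq_of_lt_iff {n : ℕ} {σ τ : Equiv.Perm (Fin n)}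
    (h : ∀ i j, i < j → (σ i < σ j ↔ τ i < τ j)) : σ = τ := by
  have key : ∀ i j, τ i < τ j → σ i < σ j := by
    intro i j hij
    rcases lt_trichotomy i j with hlt | rfl | hgt
    · exact (h i j hlt).2 hij
    · exact absurd hij (lt_irrefl _)
    · have h1 : ¬ σ j < σ i := fun hc => lt_asymm hij ((h j i hgt).1 hc)
      exact lt_of_le_of_ne (not_lt.1 h1) fun hc => hgt.ne' (σ.injective hc)
  have hm : Monotone ((id : Fin n → Fin n) ∘ (τ.symm.trans σ)) := by
    refine StrictMono.monotone fun a b hab => ?_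
    exact key _ _ (by simpa using hab)
  have h1 := Tuple.unique_monotone hm
    (show Monotone ((id : Fin n → Fin n) ∘ (1 : Equiv.Perm (Fin n))) from monotone_id)
  ext i
  have h2 := congrFun h1 (τ i)
  simp at h2
  rw [h2]

/-- To check order isomorphism it suffices to compare pairs of increasing positions. -/
theorem orderIso_of_lt {σ π : PermOn} (f : Fin σ.1 ↪o Fin π.1)
    (h : ∀ u v, u < v → (σ.2 u < σ.2 v ↔ π.2 (f u) < π.2 (f v))) (u v : Fin σ.1) :
    σ.2 u < σ.2 v ↔ π.2 (f u) < π.2 (f v) := by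
  rcases lt_trichotomy u v with hlt | rfl | hgt
  · exact h u v hlt
  · simp
  · have h1 := h v u hgt
    have h2 : σ.2 u ≠ σ.2 v := fun hc => hgt.ne' (σ.2.injective hc)
    have h3 : π.2 (f u) ≠ π.2 (f v) := fun hc => hgt.ne' (f.injective (π.2.injective hc))
    grind

/-- An injective map from a finite type to a linear order can be replaced by a bijection
to an initial segment of `ℕ`. -/
theorem exists_rank {X L : Type*} [Fintype X] [LinearOrder L] (key : X → L)
    (hk : Function.Injective key) :
    ∃ r : X ≃ Fin (Fintype.card X), ∀ x y, r x < r y ↔ key x < key y := by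
  classical
  have hc : (Finset.univ.image key).card = Fintype.card X := by
    rw [Finset.card_image_of_injective _ hk, Finset.card_univ]
  let o := (Finset.univ.image key).orderIsoOfFin hc
  let t : X → (Finset.univ.image key : Finset L) := fun x => ⟨key x, by simp⟩
  have ht : Function.Bijective t := by
    constructor
    · intro x y hxy
      exact hk (congrArg Subtype.val hxy)
    · rintro ⟨y, hy⟩
      obtain ⟨x, -, rfl⟩ := Finset.mem_image.1 hy
      exact ⟨x, rfl⟩
  refine ⟨(Equiv.ofBijective t ht).trans o.symm.toEquiv, fun x y => ?_⟩
  change o.symm (t x) < o.symm (t y) ↔ _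
  rw [o.symm.lt_iff_lt]
  rfl

/-- Two injective keys on a finite type, read as positions and as values, determine a
permutation. -/
theorem exists_permOn {X L M : Type*} [Fintype X] [LinearOrder L] [LinearOrder M]
    (pos : X → L) (val : X → M) (hpos : Function.Injective pos)
    (hval : Function.Injective val) :
    ∃ (π : PermOn) (e : Fin π.1 ≃ X),
      (∀ i j, i < j ↔ pos (e i) < pos (e j)) ∧
      ∀ i j, π.2 i < π.2 j ↔ val (e i) < val (e j) := by
  obtain ⟨r, hr⟩ := exists_rank pos hpos
  obtain ⟨s, hs⟩ := exists_rank val hval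
  refine ⟨⟨Fintype.card X, r.symm.trans s⟩, r.symm, fun i j => ?_, fun i j => ?_⟩
  · rw [← hr]; simp
  · rw [← hs]; rfl

/-- A finite family of labels can be replaced by a surjection onto an initial segment. -/
theorem exists_compress {X L : Type*} [Fintype X] [LinearOrder L] (f : X → L) :
    ∃ (k : ℕ) (p : X → Fin k), Function.Surjective p ∧ ∀ x y, p x < p y ↔ f x < f y := by
  classical
  obtain ⟨r, hr⟩ := exists_rank (fun y : Set.range f => (y : L)) Subtype.val_injective
  refine ⟨_, fun x => r ⟨f x, x, rfl⟩, ?_, fun x y => hr _ _⟩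
  intro y
  obtain ⟨⟨_, x, rfl⟩, h⟩ := r.surjective y
  exact ⟨x, h⟩

/-- A criterion for membership in an inflation class in terms of block labels. -/
theorem mem_inflClass {A B : Set PermOn} {σ : PermOn} {k : ℕ} (π : Equiv.Perm (Fin k))
    (hπ : (⟨k, π⟩ : PermOn) ∈ A) (p : Fin σ.1 → Fin k) (hp : Monotone p)
    (hs : Function.Surjective p)
    (hv : ∀ i j, p i ≠ p j → (σ.2 i < σ.2 j ↔ π (p i) < π (p j)))
    (hB : ∀ (τ : PermOn) (e : Fin τ.1 ↪o Fin σ.1),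
      (∀ u v, τ.2 u < τ.2 v ↔ σ.2 (e u) < σ.2 (e v)) →
      (∀ u v, p (e u) = p (e v)) → τ ∈ B) :
    σ ∈ InflClass A B := by
  have hfib : ∀ q : Fin k, ∃ (τ : PermOn) (e : Fin τ.1 ≃ {i // p i = q}),
      (∀ i j, i < j ↔ (e i : Fin σ.1) < e j) ∧
      ∀ i j, τ.2 i < τ.2 j ↔ σ.2 (e i) < σ.2 (e j) := fun q =>
    exists_permOn (fun x : {i // p i = q} => (x : Fin σ.1)) (fun x => σ.2 x)
      Subtype.val_injective (σ.2.injective.comp Subtype.val_injective)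
  choose τ e he hτ using hfib
  refine ⟨⟨k, π⟩, hπ, τ, fun q => ⟨?_, ?_⟩, ?_⟩
  · refine hB (τ q) (OrderEmbedding.ofStrictMono (fun u => (e q u : Fin σ.1))
      fun u v huv => (he q u v).1 huv) (fun u v => hτ q u v) fun u v => ?_
    exact (e q u).2.trans (e q v).2.symm
  · obtain ⟨i, hi⟩ := hs q
    exact Fin.pos ((e q).symm ⟨i, hi⟩)
  · refine ⟨(Equiv.sigmaCongrRight e).trans (Equiv.sigmaFiberEquiv p), ?_, ?_, ?_, ?_⟩
    · intro i i' j j' h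
      change (e i j : Fin σ.1) < e i' j'
      by_contra hc
      have := hp (not_lt.1 hc)
      rw [(e i j).2, (e i' j').2] at this
      exact absurd h (not_lt.2 this)
    · intro i j j'
      exact (he i j j').symm
    · intro i i' j j' h
      change σ.2 (e i j) < σ.2 (e i' j') ↔ π i < π i'
      have h1 := hv (e i j) (e i' j')
      rw [(e i j).2, (e i' j').2] at h1
      exact h1 h
    · intro i j j'
      exact (hτ i j j').symm

/-- Labels for `σ` as an increasing sequence (labels `f`) of decreasing sequences
(labels `g`) of increasing runs. -/
def IsLabelling {L M : Type*} [LinearOrder L] [LinearOrder M] (σ : PermOn)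
    (f : Fin σ.1 → L) (g : Fin σ.1 → M) : Prop :=
  ∀ i j, i < j → f i ≤ f j ∧ (f i = f j → g i ≤ g j) ∧
    (σ.2 i < σ.2 j ↔ (f i = f j → g i = g j))

theorem mem_Iclass_iff {σ : PermOn} : σ ∈ Iclass ↔ ∀ i j, i < j → σ.2 i < σ.2 j := by
  constructor
  · rintro ⟨m, rfl⟩ i j hij
    exact hij
  intro h
  obtain ⟨n, s⟩ := σ
  refine ⟨n, ?_⟩
  have : s = 1 := perm_eq_of_lt_iff fun i j hij => ⟨fun _ => hij, fun _ => h i j hij⟩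
  rw [this]
  rfl

theorem mem_inflClass_D_I {M : Type*} [LinearOrder M] {σ : PermOn} (g : Fin σ.1 → M)
    (hg : Monotone g) (h : ∀ i j, i < j → (σ.2 i < σ.2 j ↔ g i = g j)) :
    σ ∈ InflClass Dclass Iclass := by
  obtain ⟨k, p, hs, hp⟩ := exists_compress g
  have hpe : ∀ i j, p i = p j ↔ g i = g j := fun i j => by
    have := hp i j
    have := hp j i
    grind
  have hpm : Monotone p := fun i j hij => not_lt.1 fun hc => not_lt.2 (hg hij) ((hp _ _).1 hc)
  refine mem_inflClass Fin.revPerm ⟨k, rfl⟩ p hpm hs ?_ ?_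
  · intro i j hij
    simp only [Fin.revPerm_apply, Fin.rev_lt_rev]
    rcases lt_trichotomy i j with hlt | rfl | hgt
    · have h1 := h i j hlt
      have h2 := hpm hlt.le
      rw [← hpe] at h1
      exact ⟨fun hc => absurd (h1.1 hc) hij, fun hc => absurd hc (not_lt.2 h2)⟩
    · exact absurd rfl hij
    · have h1 := h j i hgt
      have h2 := lt_of_le_of_ne (hpm hgt.le) (Ne.symm hij)
      rw [← hpe] at h1
      refine ⟨fun _ => h2, fun _ => ?_⟩
      have h3 : ¬ σ.2 j < σ.2 i := fun hc => hij (h1.1 hc).symm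
      exact lt_of_le_of_ne (not_lt.1 h3) fun hc => hgt.ne' (σ.2.injective hc)
  · intro τ e he hc
    refine mem_Iclass_iff.2 fun u v huv => ?_
    rw [he, h _ _ (e.lt_iff_lt.2 huv), ← hpe]
    exact hc u v

theorem IsLabelling.mem {L M : Type*} [LinearOrder L] [LinearOrder M] {σ : PermOn}
    {f : Fin σ.1 → L} {g : Fin σ.1 → M} (h : IsLabelling σ f g) :
    σ ∈ InflClass Iclass (InflClass Dclass Iclass) := by
  obtain ⟨k, p, hs, hp⟩ := exists_compress f
  have hpe : ∀ i j, p i = p j ↔ f i = f j := fun i j => by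
    have := hp i j
    have := hp j i
    grind
  have hpm : Monotone p := by
    intro i j hij
    rcases hij.eq_or_lt with rfl | hlt
    · exact le_rfl
    · exact not_lt.1 fun hc => not_lt.2 (h i j hlt).1 ((hp _ _).1 hc)
  refine mem_inflClass 1 ⟨k, rfl⟩ p hpm hs ?_ ?_
  · intro i j hij
    simp only [Equiv.Perm.coe_one, id]
    rcases lt_trichotomy i j with hlt | rfl | hgt
    · have h1 := (h i j hlt).2.2
      rw [← hpe] at h1
      exact ⟨fun _ => lt_of_le_of_ne (hpm hlt.le) hij,
        fun _ => h1.2 fun hc => absurd hc hij⟩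
    · exact absurd rfl hij
    · have h1 := (h j i hgt).2.2
      rw [← hpe] at h1
      have h2 := h1.2 fun hc => absurd hc.symm hij
      exact ⟨fun hc => absurd hc h2.asymm, fun hc => absurd hc (not_lt.2 (hpm hgt.le))⟩
  · intro τ e he hc
    have hf : ∀ u v, f (e u) = f (e v) := fun u v => (hpe _ _).1 (hc u v)
    refine mem_inflClass_D_I (fun u => g (e u)) ?_ ?_
    · intro u v huv
      rcases huv.eq_or_lt with rfl | hlt
      · exact le_rfl
      · exact (h _ _ (e.lt_iff_lt.2 hlt)).2.1 (hf u v)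
    · intro u v huv
      rw [he, (h _ _ (e.lt_iff_lt.2 huv)).2.2]
      exact ⟨fun hh => hh (hf u v), fun hh _ => hh⟩

theorem exists_label_of_mem_inflClass_D_I {σ : PermOn} (h : σ ∈ InflClass Dclass Iclass) :
    ∃ g : Fin σ.1 → ℕ, Monotone g ∧ ∀ i j, i < j → (σ.2 i < σ.2 j ↔ g i = g j) := by
  obtain ⟨_, ⟨k, rfl⟩, τ, hτ, b, h1, h2, h3, h4⟩ := h
  have hm : Monotone fun x => (b.symm x).1 := by
    intro x y hxy
    obtain ⟨⟨i, u⟩, rfl⟩ := b.surjective x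
    obtain ⟨⟨j, v⟩, rfl⟩ := b.surjective y
    simp only [Equiv.symm_apply_apply]
    exact not_lt.1 fun hc => not_lt.2 hxy (h1 _ _ _ _ hc)
  refine ⟨fun x => (b.symm x).1.val, fun x y hxy => hm hxy, fun x y hxy => ?_⟩
  have hle := hm hxy.le
  obtain ⟨⟨i, u⟩, rfl⟩ := b.surjective x
  obtain ⟨⟨j, v⟩, rfl⟩ := b.surjective y
  simp only [Equiv.symm_apply_apply] at hle ⊢
  by_cases hij : i = j
  · subst hij
    have hu : u < v := (h2 _ _ _).1 hxy
    rw [h4]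
    simpa using (mem_Iclass_iff.1 (hτ i).1) u v hu
  · rw [h3 _ _ _ _ hij]
    change Fin.rev i < Fin.rev j ↔ _
    rw [Fin.rev_lt_rev]
    exact ⟨fun hc => absurd hc (not_lt.2 hle), fun hc => absurd (Fin.ext hc) hij⟩

theorem exists_isLabelling {σ : PermOn}
    (h : σ ∈ InflClass Iclass (InflClass Dclass Iclass)) :
    ∃ f g : Fin σ.1 → ℕ, IsLabelling σ f g := by
  obtain ⟨_, ⟨k, rfl⟩, τ, hτ, b, h1, h2, h3, h4⟩ := h
  choose g hg hg' using fun i => exists_label_of_mem_inflClass_D_I (hτ i).1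
  refine ⟨fun x => (b.symm x).1.val, fun x => g _ (b.symm x).2, fun x y hxy => ?_⟩
  obtain ⟨⟨i, u⟩, rfl⟩ := b.surjective x
  obtain ⟨⟨j, v⟩, rfl⟩ := b.surjective y
  have hg₂ : ∀ z, g (b.symm (b z)).1 (b.symm (b z)).2 = g z.1 z.2 := fun z => by
    rw [b.symm_apply_apply]
  simp only [Equiv.symm_apply_apply, hg₂]
  by_cases hij : i = j
  · subst hij
    have hu : u < v := (h2 _ _ _).1 hxy
    refine ⟨le_rfl, fun _ => hg i hu.le, ?_⟩
    rw [h4, hg' i u v hu]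
    simp
  · have hle : i ≤ j := not_lt.1 fun hc => not_lt.2 hxy.le (h1 _ _ _ _ hc)
    have hne : i.val ≠ j.val := fun hc => hij (Fin.ext hc)
    refine ⟨hle, fun hc => absurd hc hne, ?_⟩
    rw [h3 _ _ _ _ hij]
    exact ⟨fun _ hc => absurd hc hne, fun _ => lt_of_le_of_ne hle hij⟩

/-- The class of layered permutations, i.e. direct sums of decreasing permutations. -/
def LayeredClass : Set PermOn :=
  { σ | ∃ f : Fin σ.1 → ℕ, Monotone f ∧ ∀ i j, i < j → (σ.2 i < σ.2 j ↔ f i < f j) }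

theorem isPermClass_layeredClass : IsPermClass LayeredClass := by
  rintro π ⟨f, hf, h⟩ σ ⟨e, he⟩
  refine ⟨f ∘ e, hf.comp e.monotone, fun i j hij => ?_⟩
  rw [he, h _ _ (e.lt_iff_lt.2 hij)]
  rfl

theorem layeredClass_ssubset :
    LayeredClass ⊂ InflClass Iclass (InflClass Dclass Iclass) := by
  rw [Set.ssubset_iff_of_subset]
  · refine ⟨⟨4, Equiv.addRight 2⟩, ?_, ?_⟩
    · refine IsLabelling.mem (f := fun _ => (0 : ℕ)) (g := ![0, 0, 1, 1]) ?_
      unfold IsLabelling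
      decide
    · rintro ⟨f, hf, h⟩
      have h1 := (h (0 : Fin 4) (1 : Fin 4) (by decide)).1 (by decide)
      have h2 := hf (show (1 : Fin 4) ≤ (2 : Fin 4) by decide)
      exact absurd ((h (0 : Fin 4) (2 : Fin 4) (by decide)).2 (h1.trans_le h2)) (by decide)
  · rintro σ ⟨f, hf, h⟩
    refine IsLabelling.mem (f := f) (g := id) fun i j hij => ⟨hf hij.le, fun _ => hij.le, ?_⟩
    rw [h i j hij]
    have := hf hij.le
    constructor
    · intro h1 h2
      exact absurd h2 h1.ne
    · intro h1
      exact lt_of_le_of_ne this fun hc => hij.ne (h1 hc)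

/-- For monotone labels there is a layered permutation reversing the blocks of equal label. -/
theorem exists_layered {n : ℕ} {L : Type*} [LinearOrder L] (f : Fin n → L) (hf : Monotone f) :
    ∃ ρ : Equiv.Perm (Fin n), (⟨n, ρ⟩ : PermOn) ∈ LayeredClass ∧ f ∘ ρ = f ∧
      ∀ i j, ρ i < ρ j ↔ f i < f j ∨ f i = f j ∧ j < i := by
  obtain ⟨r, hr⟩ := exists_rank (fun i : Fin n => toLex (f i, OrderDual.toDual i)) (by
    intro i j hij
    have h := congrArg (fun x => (ofLex x).2) hij
    simpa using h)
  simp only [Prod.Lex.toLex_lt_toLex, OrderDual.toDual_lt_toDual] at hr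
  have hr' : ∀ i j, (r.trans (finCongr (Fintype.card_fin n))) i <
      (r.trans (finCongr (Fintype.card_fin n))) j ↔ f i < f j ∨ f i = f j ∧ j < i := by
    intro i j
    rw [← hr]
    rfl
  generalize r.trans (finCongr (Fintype.card_fin n)) = ρ at hr'
  refine ⟨ρ, ?_, ?_, hr'⟩
  · obtain ⟨k, p, -, hp⟩ := exists_compress f
    refine ⟨fun i => (p i).val, fun i j hij => ?_, fun i j hij => ?_⟩
    · exact not_lt.1 fun hc => not_lt.2 (hf hij) ((hp _ _).1 hc)
    · exact ((hr' i j).trans (by simp [hij.not_gt])).trans (hp i j).symm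
  · have hm : Monotone (f ∘ ρ.symm) := by
      intro a b hab
      by_contra hc
      have := (hr' (ρ.symm b) (ρ.symm a)).2 (Or.inl (not_le.1 hc))
      simp only [Equiv.apply_symm_apply] at this
      exact absurd hab (not_le.2 this)
    have h1 := Tuple.unique_monotone hm (show Monotone (f ∘ (1 : Equiv.Perm (Fin n))) from hf)
    ext i
    have h2 := congrFun h1 (ρ i)
    simpa using h2.symm

theorem subset_compClass_layered :
    InflClass Iclass (InflClass Dclass Iclass) ⊆ CompClass LayeredClass LayeredClass := by
  intro σ hσ
  obtain ⟨f, g, h⟩ := exists_isLabelling hσ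
  have hf : Monotone f := fun i j hij => by
    rcases hij.eq_or_lt with rfl | hlt
    · exact le_rfl
    · exact (h i j hlt).1
  have hfg : Monotone fun i => toLex (f i, g i) := fun i j hij => by
    rcases hij.eq_or_lt with rfl | hlt
    · exact le_rfl
    · obtain ⟨h1, h2, -⟩ := h i j hlt
      rw [Prod.Lex.toLex_le_toLex]
      rcases h1.lt_or_eq with h1 | h1
      · exact Or.inl h1
      · exact Or.inr ⟨h1, h2 h1⟩
  obtain ⟨α, hα, -, hα'⟩ := exists_layered f hf
  obtain ⟨β, hβ, hfβ, hβ'⟩ := exists_layered _ hfg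
  refine ⟨σ.1, α, β, hα, hβ, ?_⟩
  have hfβ' : ∀ i, f (β i) = f i := fun i => by
    have := congrFun hfβ i
    simpa using congrArg (fun x => (ofLex x).1) this
  have : σ.2 = α * β := perm_eq_of_lt_iff fun i j hij => by
    obtain ⟨h1, h2, h3⟩ := h i j hij
    rw [Equiv.Perm.mul_apply, Equiv.Perm.mul_apply, hα', hfβ', hfβ', hβ', h3]
    simp only [Prod.Lex.toLex_lt_toLex, EmbeddingLike.apply_eq_iff_eq, Prod.mk.injEq]
    grind
  rw [← this]

theorem composable_I_D_I : Composable (InflClass Iclass (InflClass Dclass Iclass)) := by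
  refine ⟨[LayeredClass, LayeredClass], by simp, ?_, ?_⟩
  · intro A hA
    obtain rfl : A = LayeredClass := by simpa using hA
    exact ⟨isPermClass_layeredClass, layeredClass_ssubset⟩
  · intro σ hσ
    obtain ⟨n, α, β, hα, hβ, rfl⟩ := subset_compClass_layered hσ
    exact ⟨n, α, β, hα, ⟨n, β, 1, hβ, rfl, by simp⟩, rfl⟩

/-- A member of an iterated merge has a colouring whose monochromatic patterns lie in the
corresponding classes. -/
theorem exists_coloring_of_mem_mergeAll_s7 (As : List (Set PermOn))
    (hAs : ∀ A ∈ As, IsPermClass A) (σ : PermOn) (hσ : σ ∈ MergeAll As) :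
    ∃ c : Fin σ.1 → Fin As.length, ∀ (τ : PermOn) (e : Fin τ.1 ↪o Fin σ.1),
      (∀ u v, τ.2 u < τ.2 v ↔ σ.2 (e u) < σ.2 (e v)) →
      ∀ κ, (∀ u, c (e u) = κ) → τ ∈ As.get κ := by
  classical
  induction As generalizing σ with
  | nil =>
    have h0 : σ.1 = 0 := hσ
    exact ⟨fun i => absurd i.2 (by omega), fun _ _ _ κ => κ.elim0⟩
  | cons A As ih =>
    obtain ⟨α, hα, β, hβ, f, g, hfg, hcov, hf, hg⟩ := hσ
    obtain ⟨c, hc⟩ := ih (fun B hB => hAs B (List.mem_cons_of_mem _ hB)) β hβ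
    have hg' : ∀ i, ¬ (∃ u, f u = i) → ∃ v, g v = i := fun i hi => (hcov i).resolve_left hi
    refine ⟨fun i => if h : ∃ u, f u = i then 0 else (c (hg' i h).choose).succ, ?_⟩
    intro τ e he κ hκ
    refine Fin.cases (fun hκ => ?_) (fun κ hκ => ?_) κ hκ
    · have hw : ∀ u, ∃ w, f w = e u := fun u => by
        by_contra hcon
        have := hκ u
        simp only [dif_neg hcon] at this
        exact Fin.succ_ne_zero _ this
      choose w hw using hw
      refine hAs A List.mem_cons_self α hα τ ⟨OrderEmbedding.ofStrictMono w fun u v huv => ?_,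
        fun u v => ?_⟩
      · rw [← f.lt_iff_lt, hw, hw]
        exact e.lt_iff_lt.2 huv
      · rw [he, ← hw, ← hw, ← hf]
        rfl
    · have hw : ∀ u, ∃ w, g w = e u ∧ c w = κ := fun u => by
        have h1 := hκ u
        by_cases hcon : ∃ w, f w = e u
        · simp only [dif_pos hcon] at h1
          exact absurd h1.symm (Fin.succ_ne_zero _)
        · simp only [dif_neg hcon] at h1
          exact ⟨_, (hg' _ hcon).choose_spec, Fin.succ_injective _ h1⟩
      choose w hw hcw using hw
      refine hc τ (OrderEmbedding.ofStrictMono w fun u v huv => ?_) (fun u v => ?_) κ hcw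
      · rw [← g.lt_iff_lt, hw, hw]
        exact e.lt_iff_lt.2 huv
      · rw [he, ← hw, ← hw, ← hg]
        rfl

theorem exists_monochromatic {n m : ℕ} (hm : 0 < m) (c : Fin (m * n) → Fin m) :
    ∃ (κ : Fin m) (φ : Fin n ↪o Fin (m * n)), ∀ i, c (φ i) = κ := by
  have : Nonempty (Fin m) := ⟨⟨0, hm⟩⟩
  obtain ⟨κ, hκ⟩ := Fintype.exists_le_card_fiber_of_mul_le_card c (n := n) (by simp)
  refine ⟨κ, Finset.orderEmbOfCardLe _ hκ, fun i => ?_⟩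
  simpa using Finset.orderEmbOfCardLe_mem _ hκ i

/-- The order of positions on the index set of the inflation `ι_N[δ_N[ι_N]]`. -/
def posKey {N : ℕ} (x : Fin N × Fin N × Fin N) : Fin N ×ₗ Fin N ×ₗ Fin N :=
  toLex (x.1, toLex (x.2.1, x.2.2))

/-- The order of values on the index set of the inflation `ι_N[δ_N[ι_N]]`. -/
def valKey {N : ℕ} (x : Fin N × Fin N × Fin N) : Fin N ×ₗ (Fin N)ᵒᵈ ×ₗ Fin N :=
  toLex (x.1, toLex (OrderDual.toDual x.2.1, x.2.2))

theorem posKey_injective {N : ℕ} : Function.Injective (posKey (N := N)) := by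
  rintro ⟨a, b, c⟩ ⟨a', b', c'⟩ h
  simpa [posKey] using h

theorem valKey_injective {N : ℕ} : Function.Injective (valKey (N := N)) := by
  rintro ⟨a, b, c⟩ ⟨a', b', c'⟩ h
  simpa [valKey] using h

theorem posKey_lt {N : ℕ} {x y : Fin N × Fin N × Fin N} : posKey x < posKey y ↔
    x.1 < y.1 ∨ x.1 = y.1 ∧ (x.2.1 < y.2.1 ∨ x.2.1 = y.2.1 ∧ x.2.2 < y.2.2) := by
  simp [posKey, Prod.Lex.toLex_lt_toLex]

theorem valKey_lt {N : ℕ} {x y : Fin N × Fin N × Fin N} : valKey x < valKey y ↔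
    x.1 < y.1 ∨ x.1 = y.1 ∧ (y.2.1 < x.2.1 ∨ x.2.1 = y.2.1 ∧ x.2.2 < y.2.2) := by
  simp [valKey, Prod.Lex.toLex_lt_toLex]

/-- Every member of `I[D[I]]` embeds into `ι_n[δ_n[ι_n]]` for all large `n`. -/
theorem exists_embedding {σ : PermOn} (hσ : σ ∈ InflClass Iclass (InflClass Dclass Iclass)) :
    ∃ n₀ : ℕ, ∀ n, n₀ ≤ n → ∃ h : Fin σ.1 → Fin n × Fin n × Fin n,
      (∀ i j, i < j → posKey (h i) < posKey (h j)) ∧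
      ∀ i j, i < j → (σ.2 i < σ.2 j ↔ valKey (h i) < valKey (h j)) := by
  obtain ⟨f, g, hl⟩ := exists_isLabelling hσ
  refine ⟨Finset.univ.sup f + Finset.univ.sup g + σ.1 + 1, fun n hn => ?_⟩
  have hf : ∀ i, f i < n := fun i => by
    have := Finset.le_sup (f := f) (Finset.mem_univ i)
    omega
  have hg : ∀ i, g i < n := fun i => by
    have := Finset.le_sup (f := g) (Finset.mem_univ i)
    omega
  refine ⟨fun i => (⟨f i, hf i⟩, ⟨g i, hg i⟩, ⟨i, by omega⟩), fun i j hij => ?_,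
    fun i j hij => ?_⟩
  · obtain ⟨h1, h2, h3⟩ := hl i j hij
    rw [posKey_lt]
    simp only [Fin.mk_lt_mk, Fin.mk.injEq]
    have : i.val < j.val := hij
    omega
  · obtain ⟨h1, h2, h3⟩ := hl i j hij
    rw [valKey_lt, h3]
    simp only [Fin.mk_lt_mk, Fin.mk.injEq]
    have : i.val < j.val := hij
    omega

theorem exists_monochromatic_triples {n m : ℕ} (hm : 0 < m)
    (c : Fin (m * n) × Fin (m * n) × Fin (m * n) → Fin m) :
    ∃ (κ : Fin m) (t : Fin n × Fin n × Fin n → Fin (m * n) × Fin (m * n) × Fin (m * n)),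
      (∀ x, c (t x) = κ) ∧ (∀ x y, posKey (t x) < posKey (t y) ↔ posKey x < posKey y) ∧
      ∀ x y, valKey (t x) < valKey (t y) ↔ valKey x < valKey y := by
  choose κ₃ χ hχ using fun a b => exists_monochromatic hm fun d => c (a, b, d)
  choose κ₂ ψ hψ using fun a => exists_monochromatic hm fun b => κ₃ a b
  obtain ⟨κ, φ, hφ⟩ := exists_monochromatic hm κ₂
  have key : ∀ x y : Fin n × Fin n × Fin n,
      (φ x.1 = φ y.1 ↔ x.1 = y.1) ∧
      (x.1 = y.1 → (ψ (φ x.1) x.2.1 < ψ (φ y.1) y.2.1 ↔ x.2.1 < y.2.1) ∧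
        (ψ (φ y.1) y.2.1 < ψ (φ x.1) x.2.1 ↔ y.2.1 < x.2.1) ∧
        (ψ (φ x.1) x.2.1 = ψ (φ y.1) y.2.1 ↔ x.2.1 = y.2.1) ∧
        (x.2.1 = y.2.1 → (χ (φ x.1) (ψ (φ x.1) x.2.1) x.2.2 <
          χ (φ y.1) (ψ (φ y.1) y.2.1) y.2.2 ↔ x.2.2 < y.2.2))) := by
    rintro ⟨a, b, d⟩ ⟨a', b', d'⟩
    refine ⟨φ.injective.eq_iff, ?_⟩
    rintro rfl
    refine ⟨OrderEmbedding.lt_iff_lt _, OrderEmbedding.lt_iff_lt _,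
      (ψ (φ a)).injective.eq_iff, ?_⟩
    rintro rfl
    exact OrderEmbedding.lt_iff_lt _
  refine ⟨κ, fun x => (φ x.1, ψ (φ x.1) x.2.1, χ (φ x.1) (ψ (φ x.1) x.2.1) x.2.2), fun x => ?_,
    fun x y => ?_, fun x y => ?_⟩
  · rw [hχ, hψ, hφ]
  · obtain ⟨h1, h2⟩ := key x y
    rw [posKey_lt, posKey_lt]
    simp only [φ.lt_iff_lt, h1]
    refine or_congr Iff.rfl (and_congr_right fun h => ?_)
    obtain ⟨h3, -, h5, h6⟩ := h2 h
    rw [h3, h5]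
    exact or_congr Iff.rfl (and_congr_right h6)
  · obtain ⟨h1, h2⟩ := key x y
    rw [valKey_lt, valKey_lt]
    simp only [φ.lt_iff_lt, h1]
    refine or_congr Iff.rfl (and_congr_right fun h => ?_)
    obtain ⟨-, h4, h5, h6⟩ := h2 h
    rw [h4, h5]
    exact or_congr Iff.rfl (and_congr_right h6)

theorem isLabelling_of_triples {N : ℕ} {π : PermOn} (e : Fin π.1 → Fin N × Fin N × Fin N)
    (hpos : ∀ i j, i < j ↔ posKey (e i) < posKey (e j))
    (hval : ∀ i j, π.2 i < π.2 j ↔ valKey (e i) < valKey (e j)) :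
    IsLabelling π (fun i => (e i).1) fun i => (e i).2.1 := by
  intro i j hij
  have h := (hpos i j).1 hij
  rw [posKey_lt] at h
  rw [hval, valKey_lt]
  grind

theorem not_splittable_I_D_I : ¬ Splittable (InflClass Iclass (InflClass Dclass Iclass)) := by
  rintro ⟨As, hne, hA, hsub⟩
  have hm : 0 < As.length := List.length_pos_iff.2 hne
  choose π hπ hπA using fun κ : Fin As.length =>
    Set.exists_of_ssubset (hA _ (As.get_mem κ)).2
  choose n₀ hn₀ using fun κ => exists_embedding (hπ κ)
  set n := Finset.univ.sup n₀
  obtain ⟨U, e, hpos, hval⟩ := exists_permOn (posKey (N := As.length * n)) valKey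
    posKey_injective valKey_injective
  obtain ⟨c, hc⟩ := exists_coloring_of_mem_mergeAll_s7 As (fun A h => (hA A h).1) U
    (hsub (isLabelling_of_triples e hpos hval).mem)
  obtain ⟨κ, t, ht, htpos, htval⟩ := exists_monochromatic_triples hm fun x => c (e.symm x)
  obtain ⟨h, hhpos, hhval⟩ := hn₀ κ n (Finset.le_sup (Finset.mem_univ κ))
  let w : Fin (π κ).1 ↪o Fin U.1 := OrderEmbedding.ofStrictMono (fun u => e.symm (t (h u)))
    fun u v huv => by
      rw [hpos]
      simpa [htpos] using hhpos u v huv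
  refine hπA κ (hc (π κ) w (orderIso_of_lt w fun u v huv => ?_) κ fun u => ht (h u))
  have hw : ∀ u, e (w u) = t (h u) := fun u => e.apply_symm_apply _
  rw [hval, hhval u v huv, hw, hw, htval]

/-- The class `C = I[D[I]]` is composable but unsplittable. -/
theorem stmt_7 :
    Composable (InflClass Iclass (InflClass Dclass Iclass)) ∧
    ¬ Splittable (InflClass Iclass (InflClass Dclass Iclass)) := by
  exact ⟨composable_I_D_I, not_splittable_I_D_I⟩
end

section
/- Let L = I[D] be the class of layered permutations and C = I[D[I]]. Then L is a proper subclass of C and C ⊆ L ∘ L; in particular C is 2-composable. -/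
/-- A permutation whose positions are cut into intervals by a monotone surjection `c`, with the
blocks ordered in value as `π`, is an inflation of `π` by the patterns of the blocks. -/
theorem mem_inflClass_of_coloring {A B : Set PermOn} {τ : PermOn} {k : ℕ}
    {π : Equiv.Perm (Fin k)} (hπ : (⟨k, π⟩ : PermOn) ∈ A) (c : Fin τ.1 → Fin k)
    (hmono : Monotone c) (hsurj : Function.Surjective c)
    (hval : ∀ x y, c x ≠ c y → (τ.2 x < τ.2 y ↔ π (c x) < π (c y)))
    (hB : ∀ i, ∃ σ ∈ B, ∃ e : Fin σ.1 ≃o {x // c x = i},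
      ∀ u v, τ.2 (e u) < τ.2 (e v) ↔ σ.2 u < σ.2 v) :
    τ ∈ InflClass A B := by
  choose σs hσ e he using hB
  refine ⟨⟨k, π⟩, hπ, σs, fun i => ⟨hσ i, ?_⟩,
    (Equiv.sigmaCongrRight fun i => (e i).toEquiv).trans (Equiv.sigmaFiberEquiv c),
    ?_, ?_, ?_, ?_⟩
  · obtain ⟨x, hx⟩ := hsurj i
    exact Fin.pos ((e i).symm ⟨x, hx⟩)
  · intro i i' j j' h
    change (e i j : Fin τ.1) < e i' j'
    refine hmono.reflect_lt ?_
    rw [(e i j).2, (e i' j').2]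
    exact h
  · intro i j j'
    change (e i j : Fin τ.1) < e i j' ↔ _
    rw [Subtype.coe_lt_coe, (e i).lt_iff_lt]
  · intro i i' j j' h
    change τ.2 (e i j : Fin τ.1) < τ.2 (e i' j') ↔ _
    have := hval (e i j) (e i' j')
    rw [(e i j).2, (e i' j').2] at this
    exact this h
  · intro i j j'
    exact he i j j'

theorem mem_inflClass_Dclass_of_coloring {A : Set PermOn} {τ : PermOn} {k : ℕ}
    {π : Equiv.Perm (Fin k)} (hπ : (⟨k, π⟩ : PermOn) ∈ A) (c : Fin τ.1 → Fin k)
    (hmono : Monotone c) (hsurj : Function.Surjective c)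
    (hval : ∀ x y, c x ≠ c y → (τ.2 x < τ.2 y ↔ π (c x) < π (c y)))
    (hdec : ∀ x y, c x = c y → (τ.2 x < τ.2 y ↔ y < x)) :
    τ ∈ InflClass A Dclass := by
  refine mem_inflClass_of_coloring hπ c hmono hsurj hval fun i => ?_
  let e := Fintype.orderIsoFinOfCardEq {x // c x = i} rfl
  refine ⟨delta (Fintype.card {x // c x = i}), ⟨_, rfl⟩, e, fun u v => ?_⟩
  refine (hdec _ _ ((e u).2.trans (e v).2.symm)).trans ?_
  rw [Subtype.coe_lt_coe]
  refine e.lt_iff_lt.trans ?_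
  exact Fin.rev_lt_rev.symm

theorem mem_inflClass_Iclass_of_coloring {A : Set PermOn} {τ : PermOn} {k : ℕ}
    {π : Equiv.Perm (Fin k)} (hπ : (⟨k, π⟩ : PermOn) ∈ A) (c : Fin τ.1 → Fin k)
    (hmono : Monotone c) (hsurj : Function.Surjective c)
    (hval : ∀ x y, c x ≠ c y → (τ.2 x < τ.2 y ↔ π (c x) < π (c y)))
    (hinc : ∀ x y, c x = c y → (τ.2 x < τ.2 y ↔ x < y)) :
    τ ∈ InflClass A Iclass := by
  refine mem_inflClass_of_coloring hπ c hmono hsurj hval fun i => ?_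
  let e := Fintype.orderIsoFinOfCardEq {x // c x = i} rfl
  refine ⟨iota (Fintype.card {x // c x = i}), ⟨_, rfl⟩, e, fun u v => ?_⟩
  refine (hinc _ _ ((e u).2.trans (e v).2.symm)).trans ?_
  rw [Subtype.coe_lt_coe]
  refine e.lt_iff_lt.trans ?_
  exact Iff.rfl

/-- A permutation is layered as soon as its positions carry a monotone coloring that detects its
non-inversions. -/
theorem mem_layered_of_coloring {γ : Type*} [LinearOrder γ] {τ : PermOn} (c : Fin τ.1 → γ)
    (hmono : Monotone c) (h : ∀ i j, i < j → (τ.2 i < τ.2 j ↔ c i < c j)) :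
    τ ∈ InflClass Iclass Dclass := by
  let s := Finset.univ.image c
  let e : s ≃o Fin s.card := (s.orderIsoOfFin rfl).symm
  let c' : Fin τ.1 → Fin s.card := fun x => e ⟨c x, by simp [s]⟩
  have hlt : ∀ x y, c' x < c' y ↔ c x < c y := fun x y => by simp [c']
  have heq : ∀ x y, c' x = c' y ↔ c x = c y := fun x y => by simp [c']
  refine mem_inflClass_Dclass_of_coloring (π := 1) ⟨s.card, rfl⟩ c' ?_ ?_ ?_ ?_
  · intro x y hxy
    exact e.monotone (hmono hxy)
  · intro i
    obtain ⟨x, -, hx⟩ := Finset.mem_image.1 (e.symm i).2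
    exact ⟨x, by simp [c', hx]⟩
  · intro x y hxy
    rw [Equiv.Perm.one_apply, Equiv.Perm.one_apply, hlt]
    rw [Ne, heq] at hxy
    rcases lt_trichotomy x y with hl | rfl | hl
    · exact h x y hl
    · exact absurd rfl hxy
    · have h1 := h y x hl
      have h2 := (hmono hl.le).lt_of_ne (Ne.symm hxy)
      exact iff_of_false (h1.2 h2).not_gt h2.not_gt
  · intro x y hxy
    rw [heq] at hxy
    rcases lt_trichotomy x y with hl | rfl | hl
    · exact iff_of_false (fun hh => ((h x y hl).1 hh).ne hxy) hl.not_gt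
    · simp
    · refine iff_of_true ?_ hl
      refine lt_of_le_of_ne (not_lt.1 fun hh => ((h y x hl).1 hh).ne' hxy) ?_
      exact fun hh => hl.ne' (τ.2.injective hh)

/-- The blocks of an inflation color the positions; a property `P` of the pairs of positions
in each block, described by a coloring `d` of the block, is inherited. -/
theorem exists_coloring_of_mem_inflClass {A B : Set PermOn} {γ : Type*} {P : γ → γ → Prop → Prop}
    (hB : ∀ σ ∈ B, ∃ d : Fin σ.1 → γ, ∀ u v, u < v → P (d u) (d v) (σ.2 u < σ.2 v))
    {τ : PermOn} (hτ : τ ∈ InflClass A B) :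
    ∃ π ∈ A, ∃ (c : Fin τ.1 → Fin π.1) (d : Fin τ.1 → γ), Monotone c ∧
      (∀ x y, c x ≠ c y → (τ.2 x < τ.2 y ↔ π.2 (c x) < π.2 (c y))) ∧
      ∀ x y, x < y → c x = c y → P (d x) (d y) (τ.2 x < τ.2 y) := by
  obtain ⟨π, hπ, σs, hσ, b, h1, h2, h3, h4⟩ := hτ
  choose d hd using fun i => hB (σs i) (hσ i).1
  refine ⟨π, hπ, fun x => (b.symm x).1, fun x => d _ (b.symm x).2, ?_, ?_, ?_⟩
  · intro x y hxy
    by_contra! hlt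
    have := h1 _ _ (b.symm y).2 (b.symm x).2 hlt
    simp only [Sigma.eta, Equiv.apply_symm_apply] at this
    exact absurd hxy this.not_ge
  · intro x y hne
    simpa using h3 _ _ (b.symm x).2 (b.symm y).2 hne
  · intro x y
    obtain ⟨⟨i, u⟩, rfl⟩ := b.surjective x
    obtain ⟨⟨j, v⟩, rfl⟩ := b.surjective y
    simp only [Equiv.symm_apply_apply]
    rintro hlt rfl
    rw [h4 i u v, Equiv.symm_apply_apply, Equiv.symm_apply_apply]
    exact hd i u v ((h2 i u v).1 hlt)

theorem exists_coloring_of_mem_layered {τ : PermOn} (hτ : τ ∈ InflClass Iclass Dclass) :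
    ∃ (k : ℕ) (c : Fin τ.1 → Fin k), Monotone c ∧
      ∀ i j, i < j → (τ.2 i < τ.2 j ↔ c i < c j) := by
  obtain ⟨_, ⟨k, rfl⟩, c, -, hmono, hne, heq⟩ :=
    exists_coloring_of_mem_inflClass (γ := Unit) (P := fun _ _ q => ¬ q) (by
      rintro _ ⟨m, rfl⟩
      exact ⟨fun _ => (), fun u v huv => (Fin.rev_lt_rev.2 huv).not_gt⟩) hτ
  refine ⟨k, c, hmono, fun i j hij => ?_⟩
  by_cases h : c i = c j
  · exact iff_of_false (heq i j hij h) h.not_lt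
  · exact hne i j h

theorem isPermClass_layered : IsPermClass (InflClass Iclass Dclass) := by
  rintro π hπ σ ⟨f, hf⟩
  obtain ⟨k, c, hmono, h⟩ := exists_coloring_of_mem_layered hπ
  refine mem_layered_of_coloring (c ∘ f) (hmono.comp f.monotone) fun i j hij => ?_
  rw [hf, h _ _ (f.lt_iff_lt.2 hij)]
  rfl

theorem exists_coloring_of_mem_inflClass_Dclass_Iclass {τ : PermOn}
    (hτ : τ ∈ InflClass Dclass Iclass) :
    ∃ d : Fin τ.1 → ℕ, ∀ i j, i < j → d i ≤ d j ∧ (τ.2 i < τ.2 j ↔ d i = d j) := by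
  obtain ⟨_, ⟨k, rfl⟩, c, -, hmono, hne, heq⟩ :=
    exists_coloring_of_mem_inflClass (γ := Unit) (P := fun _ _ q => q) (by
      rintro _ ⟨m, rfl⟩
      exact ⟨fun _ => (), fun u v huv => huv⟩) hτ
  refine ⟨fun x => c x, fun i j hij => ⟨hmono hij.le, ?_⟩⟩
  rw [Fin.val_inj]
  by_cases h : c i = c j
  · exact iff_of_true (heq i j hij h) h
  · refine iff_of_false (fun hh => ?_) h
    exact (Fin.rev_lt_rev.1 ((hne i j h).1 hh)).not_ge (hmono hij.le)

/-- A permutation moving the color classes of a monotone coloring as the identity does preserves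
the coloring. -/
theorem apply_perm_eq_of_coloring {n k : ℕ} {c : Fin n → Fin k} (hmono : Monotone c)
    {σ : Equiv.Perm (Fin n)} (h : ∀ i j, c i < c j → σ i < σ j) (i : Fin n) :
    c (σ i) = c i := by
  have hmono' : Monotone (c ∘ σ.symm) := by
    intro a b hab
    by_contra! hlt
    have := h _ _ hlt
    simp only [Equiv.apply_symm_apply] at this
    exact this.not_ge hab
  have := Tuple.unique_monotone (σ := 1) (τ := σ.symm) (f := c) hmono hmono'
  simpa using congrFun this (σ i)

theorem exists_perm_lt_iff {n : ℕ} {γ : Type*} [LinearOrder γ] {f : Fin n → γ}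
    (hf : Function.Injective f) :
    ∃ σ : Equiv.Perm (Fin n), ∀ i j, σ i < σ j ↔ f i < f j := by
  refine ⟨(Tuple.sort f).symm, fun i j => ?_⟩
  have hs : StrictMono (f ∘ Tuple.sort f) :=
    (Tuple.monotone_sort f).strictMono_of_injective (hf.comp (Tuple.sort f).injective)
  simpa using (hs.lt_iff_lt (a := (Tuple.sort f).symm i) (b := (Tuple.sort f).symm j)).symm

theorem inflClass_subset_layered_comp_layered :
    InflClass Iclass (InflClass Dclass Iclass)
      ⊆ CompClass (InflClass Iclass Dclass) (InflClass Iclass Dclass) := by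
  rintro ⟨n, τ⟩ hτ
  obtain ⟨_, ⟨k, rfl⟩, c, d, hmono, hne, heq⟩ :=
    exists_coloring_of_mem_inflClass (γ := ℕ) (P := fun a b q => a ≤ b ∧ (q ↔ a = b))
      (fun _ => exists_coloring_of_mem_inflClass_Dclass_Iclass) hτ
  change Fin n → Fin k at c
  change Fin n → ℕ at d
  change ∀ x y, c x ≠ c y → (τ x < τ y ↔ c x < c y) at hne
  change ∀ x y, x < y → c x = c y → d x ≤ d y ∧ (τ x < τ y ↔ d x = d y) at heq
  obtain ⟨α, hα⟩ := exists_perm_lt_iff (f := fun i => toLex (c i, OrderDual.toDual i))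
    fun i j h => by simpa using congrArg (fun p => (ofLex p).2) h
  simp only [Prod.Lex.toLex_lt_toLex, OrderDual.toDual_lt_toDual] at hα
  have hcα : ∀ i, c (α i) = c i :=
    apply_perm_eq_of_coloring hmono fun i j h => (hα i j).2 (Or.inl h)
  have hcτ : ∀ i, c (τ i) = c i :=
    apply_perm_eq_of_coloring hmono fun i j h => (hne i j h.ne).2 h
  set β := α⁻¹ * τ with hβ
  have hαβ : ∀ i, α (β i) = τ i := fun i => by simp [hβ]
  have hcβ : ∀ i, c (β i) = c i := fun i => by rw [← hcα, hαβ, hcτ]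
  have hβeq : ∀ i j, c i = c j → (β i < β j ↔ τ j < τ i) := fun i j h => by
    rw [← hαβ, ← hαβ, hα, hcβ, hcβ, h]
    simp
  refine ⟨n, α, β, ?_, ?_, by simp [hβ]⟩
  · refine mem_layered_of_coloring c hmono fun i j hij => (hα i j).trans ?_
    simp [hij.not_gt]
  · refine mem_layered_of_coloring (fun i => toLex (c i, d i)) ?_ fun i j hij => ?_
    · intro i j hij
      rcases hij.eq_or_lt with rfl | hlt
      · rfl
      rw [Prod.Lex.toLex_le_toLex]
      rcases (hmono hij).lt_or_eq with h | h
      · exact Or.inl h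
      · exact Or.inr ⟨h, (heq i j hlt h).1⟩
    · rw [Prod.Lex.toLex_lt_toLex]
      rcases (hmono hij.le).lt_or_eq with h | h
      · refine iff_of_true ?_ (Or.inl h)
        refine hmono.reflect_lt ?_
        rwa [hcβ, hcβ]
      · obtain ⟨hle, hiff⟩ := heq i j hij h
        have hτne : τ i ≠ τ j := fun hh => hij.ne (τ.injective hh)
        change β i < β j ↔ _
        rw [hβeq i j h]
        constructor
        · intro hlt
          exact Or.inr ⟨h, hle.lt_of_ne fun hd => (hiff.2 hd).not_gt hlt⟩
        · rintro (hlt | ⟨-, hlt⟩)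
          · exact absurd h hlt.ne
          · exact (not_lt.1 fun hh => hlt.ne (hiff.1 hh)).lt_of_ne hτne.symm

theorem inflClass_mono_right (A : Set PermOn) {B B' : Set PermOn} (h : B ⊆ B') :
    InflClass A B ⊆ InflClass A B' := by
  rintro τ ⟨π, hπ, σs, hσ, hτ⟩
  exact ⟨π, hπ, σs, fun i => ⟨h (hσ i).1, (hσ i).2⟩, hτ⟩

theorem Dclass_subset_inflClass : Dclass ⊆ InflClass Dclass Iclass := by
  rintro _ ⟨n, rfl⟩
  refine mem_inflClass_Iclass_of_coloring (π := Fin.revPerm) ⟨n, rfl⟩ id monotone_id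
    Function.surjective_id (fun _ _ _ => Iff.rfl) ?_
  rintro x _ rfl
  simp

theorem mem_inflClass_Iclass_left {B : Set PermOn} {σ : PermOn} (hσ : σ ∈ B) (hpos : 0 < σ.1) :
    σ ∈ InflClass Iclass B := by
  refine ⟨iota 1, ⟨1, rfl⟩, fun _ => σ, fun _ => ⟨hσ, hpos⟩,
    (Equiv.sigmaEquivProd (Fin 1) (Fin σ.1)).trans (Equiv.uniqueProd (Fin σ.1) (Fin 1)),
    ?_, ?_, ?_, ?_⟩
  · intro i i' j j' h
    exact absurd (Subsingleton.elim (α := Fin 1) i i') h.ne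
  · intro i j j'
    rfl
  · intro i i' j j' h
    exact absurd (Subsingleton.elim (α := Fin 1) i i') h
  · intro i j j'
    rfl

/-- The permutation `231`, which belongs to `D[I]`, is not layered. -/
theorem layered_ssubset :
    InflClass Iclass Dclass ⊂ InflClass Iclass (InflClass Dclass Iclass) := by
  refine Set.ssubset_iff_exists.2 ⟨inflClass_mono_right _ Dclass_subset_inflClass,
    ⟨3, finRotate 3⟩, mem_inflClass_Iclass_left ?_ (by decide), fun h => ?_⟩
  · refine mem_inflClass_Iclass_of_coloring (π := Fin.revPerm) (k := 2) ⟨2, rfl⟩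
      (show Fin 3 → Fin 2 from ![0, 0, 1]) ?_ ?_ ?_ ?_
    · change ∀ x y : Fin 3, _
      decide
    · change ∀ i : Fin 2, ∃ x : Fin 3, _
      decide
    · change ∀ x y : Fin 3, _
      decide
    · change ∀ x y : Fin 3, _
      decide
  · obtain ⟨k, c, hmono, hc⟩ := exists_coloring_of_mem_layered h
    change Fin 3 → Fin k at c
    have h01 : c 0 < c 1 := (hc (0 : Fin 3) (1 : Fin 3) (by decide)).1 (by decide)
    have h12 : c 1 ≤ c 2 := hmono (show (1 : Fin 3) ≤ 2 by decide)
    have h02 : ¬ c 0 < c 2 := fun hh =>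
      absurd ((hc (0 : Fin 3) (2 : Fin 3) (by decide)).2 hh) (by decide)
    exact h02 (h01.trans_le h12)

/-- With `L = I[D]` (the layered permutations) and
`C = I[D[I]]`, the class `L` is a proper subclass of `C` and `C ⊆ L ∘ L`;
in particular `C` is 2-composable. -/
theorem stmt_8 :
    IsPermClass (InflClass Iclass Dclass) ∧
    InflClass Iclass Dclass ⊂ InflClass Iclass (InflClass Dclass Iclass) ∧
    InflClass Iclass (InflClass Dclass Iclass)
      ⊆ CompClass (InflClass Iclass Dclass) (InflClass Iclass Dclass) ∧
    (∃ A B : Set PermOn, IsPermClass A ∧ IsPermClass B ∧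
      A ⊂ InflClass Iclass (InflClass Dclass Iclass) ∧
      B ⊂ InflClass Iclass (InflClass Dclass Iclass) ∧
      InflClass Iclass (InflClass Dclass Iclass) ⊆ CompClass A B) := by
  exact ⟨isPermClass_layered, layered_ssubset, inflClass_subset_layered_comp_layered,
    _, _, isPermClass_layered, isPermClass_layered, layered_ssubset, layered_ssubset,
    inflClass_subset_layered_comp_layered⟩
end

section
/- Let k, ℓ ≥ 1 and let α and β be permutations of the same length such that α avoids δ_{k+1} and β avoids δ_{ℓ+1}. Then α ∘ β avoids δ_{kℓ+1}. Consequently, if A ⊆ I_k and B ⊆ I_ℓ are permutation classes, then A ∘ B ⊆ I_{kℓ}. -/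
/-- If `g` has no strictly increasing subsequence of length `k + 1`, then the lengths of the
longest increasing subsequences ending at each position label the positions by `1, …, k`,
strictly increasing along every increasing pair. -/
theorem exists_label_of_strictMonoOn_card_le {ι γ : Type*} [LinearOrder ι] [Fintype ι]
    [LinearOrder γ] (g : ι → γ) (k : ℕ)
    (h : ∀ S : Finset ι, StrictMonoOn g S → S.card ≤ k) :
    ∃ c : ι → ℕ, (∀ i, c i ∈ Finset.Icc 1 k) ∧ ∀ i j, i < j → g i < g j → c i < c j := by
  classical
  let T (i : ι) : Finset (Finset ι) :=
    Finset.univ.filter fun S => i ∈ S ∧ (∀ a ∈ S, a ≤ i) ∧ StrictMonoOn g S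
  have single_mem (i : ι) : {i} ∈ T i := by simp [T]
  refine ⟨fun i => (T i).sup Finset.card, fun i => ?_, fun i j hij hg => ?_⟩
  · rw [Finset.mem_Icc]
    refine ⟨Finset.le_sup (f := Finset.card) (single_mem i), Finset.sup_le fun S hS => ?_⟩
    exact h S (Finset.mem_filter.1 hS).2.2.2
  · obtain ⟨S, hS, hmax⟩ := Finset.exists_mem_eq_sup (T i) ⟨_, single_mem i⟩ Finset.card
    obtain ⟨-, hiS, hle, hmono⟩ := Finset.mem_filter.1 hS
    have hjS : j ∉ S := fun hj => (hle j hj).not_gt hij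
    have hins : insert j S ∈ T j := by
      refine Finset.mem_filter.2 ⟨Finset.mem_univ _, Finset.mem_insert_self _ _, ?_, ?_⟩
      · intro a ha
        rcases Finset.mem_insert.1 ha with rfl | ha
        · exact le_rfl
        · exact (hle a ha).trans hij.le
      · intro a ha b hb hab
        rcases Finset.mem_insert.1 (Finset.mem_coe.1 ha) with rfl | haS <;>
          rcases Finset.mem_insert.1 (Finset.mem_coe.1 hb) with rfl | hbS
        · exact absurd hab (lt_irrefl _)
        · exact absurd (hab.trans_le (hle b hbS)) hij.not_gt
        · exact (hmono.monotoneOn haS hiS (hle a haS)).trans_lt hg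
        · exact hmono haS hbS hab
    calc (T i).sup Finset.card = S.card := hmax
      _ < (insert j S).card := by rw [Finset.card_insert_of_notMem hjS]; exact Nat.lt_succ_self _
      _ ≤ (T j).sup Finset.card := Finset.le_sup (f := Finset.card) hins

/-- The Erdős–Szekeres theorem. -/
theorem exists_strictMonoOn_or_strictAntiOn {ι γ : Type*} [LinearOrder ι] [Fintype ι]
    [LinearOrder γ] (g : ι → γ) (hg : Function.Injective g) (k l : ℕ)
    (hcard : k * l < Fintype.card ι) :
    (∃ S : Finset ι, k < S.card ∧ StrictMonoOn g S) ∨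
      ∃ S : Finset ι, l < S.card ∧ StrictAntiOn g S := by
  by_contra! hcon
  obtain ⟨hmono, hanti⟩ := hcon
  obtain ⟨c, hc, hcl⟩ := exists_label_of_strictMonoOn_card_le g k
    fun S hS => not_lt.1 fun hlt => hmono S hlt hS
  obtain ⟨d, hd, hdl⟩ := exists_label_of_strictMonoOn_card_le (OrderDual.toDual ∘ g) l
    fun S hS => not_lt.1 fun hlt => hanti S hlt fun a ha b hb hab => hS ha hb hab
  obtain ⟨x, -, y, -, hne, hxy⟩ := Finset.exists_ne_map_eq_of_card_lt_of_maps_to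
    (s := Finset.univ) (t := Finset.Icc 1 k ×ˢ Finset.Icc 1 l) (f := fun i => (c i, d i))
    (by simpa using hcard) fun i _ => Finset.mem_product.2 ⟨hc i, hd i⟩
  rw [Prod.mk.injEq] at hxy
  wlog hlt : x < y generalizing x y
  · exact this y x hne.symm ⟨hxy.1.symm, hxy.2.symm⟩ (hne.lt_or_gt.resolve_left hlt)
  rcases (hg.ne hne).lt_or_gt with h | h
  · exact (hcl x y hlt h).ne hxy.1
  · exact (hdl x y hlt h).ne hxy.2

theorem pattLe_delta_iff {m n : ℕ} {π : Equiv.Perm (Fin n)} :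
    PattLe (delta m) ⟨n, π⟩ ↔ ∃ f : Fin m → Fin n, StrictMono f ∧ StrictAnti (π ∘ f) := by
  constructor
  · rintro ⟨f, hf⟩
    exact ⟨f, f.strictMono, fun u v huv => (hf v u).1 (Fin.rev_lt_rev.2 huv)⟩
  · rintro ⟨f, hf, hπ⟩
    exact ⟨OrderEmbedding.ofStrictMono f hf, fun u v => Fin.rev_lt_rev.trans hπ.lt_iff_gt.symm⟩

theorem not_pattLe_delta_mul {k l n : ℕ} {α β : Equiv.Perm (Fin n)}
    (hα : ¬ PattLe (delta (k + 1)) ⟨n, α⟩) (hβ : ¬ PattLe (delta (l + 1)) ⟨n, β⟩) :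
    ¬ PattLe (delta (k * l + 1)) ⟨n, α * β⟩ := by
  simp only [pattLe_delta_iff] at hα hβ ⊢
  rintro ⟨f, hf, hanti⟩
  rcases exists_strictMonoOn_or_strictAntiOn (β ∘ f) (β.injective.comp hf.injective) k l
    (by simp) with ⟨S, hS, hmono⟩ | ⟨S, hS, hdec⟩
  · refine hα ⟨β ∘ f ∘ S.orderEmbOfCardLe hS, fun u v huv => ?_, fun u v huv => ?_⟩
    · exact hmono (S.orderEmbOfCardLe_mem hS u) (S.orderEmbOfCardLe_mem hS v)
        ((S.orderEmbOfCardLe hS).strictMono huv)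
    · exact hanti ((S.orderEmbOfCardLe hS).strictMono huv)
  · refine hβ ⟨f ∘ S.orderEmbOfCardLe hS, hf.comp (S.orderEmbOfCardLe hS).strictMono,
      fun u v huv => ?_⟩
    exact hdec (S.orderEmbOfCardLe_mem hS u) (S.orderEmbOfCardLe_mem hS v)
      ((S.orderEmbOfCardLe hS).strictMono huv)

/-- If `α` avoids `δ_{k+1}` and `β` avoids `δ_{ℓ+1}` (same
length), then `α ∘ β` avoids `δ_{kℓ+1}`; consequently for permutation classes
`A ⊆ I_k` and `B ⊆ I_ℓ` one has `A ∘ B ⊆ I_{kℓ}`. -/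
theorem stmt_10 (k l : ℕ) (hk : 1 ≤ k) (hl : 1 ≤ l) :
    (∀ (n : ℕ) (α β : Equiv.Perm (Fin n)),
      ¬ PattLe (delta (k + 1)) ⟨n, α⟩ → ¬ PattLe (delta (l + 1)) ⟨n, β⟩ →
      ¬ PattLe (delta (k * l + 1)) ⟨n, α * β⟩) ∧
    (∀ A B : Set PermOn, IsPermClass A → IsPermClass B →
      A ⊆ Im k → B ⊆ Im l → CompClass A B ⊆ Im (k * l)) := by
  refine ⟨fun n α β => not_pattLe_delta_mul, fun A B _ _ hA hB => ?_⟩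
  rintro _ ⟨n, α, β, hα, hβ, rfl⟩
  exact not_pattLe_delta_mul (hA hα) (hB hβ)
end

section
/- If C is an infinite composable permutation class that avoids some increasing permutation ι_{m+1} or some decreasing permutation δ_{m+1}, then C is splittable. -/
/-- The permutations with no two entries in positions `u < v` whose values are related by `r`. -/
def AvoidsPair (r : ℕ → ℕ → Prop) : Set PermOn :=
  { σ | ∀ u v : Fin σ.1, u < v → ¬ r (σ.2 u) (σ.2 v) }

/-- `σ` has a subsequence of length `k` whose values are pairwise related by `r`. -/
def HasChain (r : ℕ → ℕ → Prop) (k : ℕ) (σ : PermOn) : Prop :=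
  ∃ f : Fin k ↪o Fin σ.1, ∀ u v, u < v → r (σ.2 (f u)) (σ.2 (f v))

/-- `r` is the usual strict order on `ℕ` or its reverse. -/
def IsLtOrGt (r : ℕ → ℕ → Prop) : Prop :=
  (∀ a b, r a b ↔ a < b) ∨ (∀ a b, r a b ↔ b < a)

theorem IsLtOrGt.trans {r : ℕ → ℕ → Prop} (hr : IsLtOrGt r) {a b c : ℕ}
    (hab : r a b) (hbc : r b c) : r a c := by
  rcases hr with hr | hr <;> rw [hr] at * <;> omega

theorem IsLtOrGt.comp_iff {r : ℕ → ℕ → Prop} (hr : IsLtOrGt r) {σ π : PermOn}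
    {f : Fin σ.1 → Fin π.1} (hf : ∀ u v, σ.2 u < σ.2 v ↔ π.2 (f u) < π.2 (f v))
    (u v : Fin σ.1) : r (σ.2 u) (σ.2 v) ↔ r (π.2 (f u)) (π.2 (f v)) := by
  rcases hr with hr | hr <;> rw [hr, hr]
  · exact hf u v
  · exact hf v u

theorem exists_pattern_on (σ : PermOn) (p : Fin σ.1 → Prop) :
    ∃ (α : PermOn) (f : Fin α.1 ↪o Fin σ.1), (∀ i, (∃ u, f u = i) ↔ p i) ∧
      ∀ u v, α.2 u < α.2 v ↔ σ.2 (f u) < σ.2 (f v) := by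
  classical
  let s : Finset (Fin σ.1) := Finset.univ.filter p
  let f := s.orderEmbOfFin rfl
  let e := (s.map σ.2.toEmbedding).orderIsoOfFin (Finset.card_map _)
  have hmem (u : Fin s.card) : σ.2 (f u) ∈ s.map σ.2.toEmbedding :=
    Finset.mem_map_of_mem _ (s.orderEmbOfFin_mem rfl u)
  let a : Fin s.card → Fin s.card := fun u => e.symm ⟨σ.2 (f u), hmem u⟩
  have ha : Function.Injective a := by
    intro u v huv
    simpa [a] using huv
  refine ⟨⟨s.card, Equiv.ofBijective a (Finite.injective_iff_bijective.mp ha)⟩, f, ?_, ?_⟩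
  · intro i
    exact (Set.ext_iff.mp (s.range_orderEmbOfFin rfl) i).trans (by simp [s])
  · intro u v
    simp [a]

theorem IsMerge.pattLe_left {σ α β : PermOn} (h : IsMerge σ α β) : PattLe α σ := by
  obtain ⟨f, -, -, -, hf, -⟩ := h
  exact ⟨f, hf⟩

theorem IsMerge.pattLe_right {σ α β : PermOn} (h : IsMerge σ α β) : PattLe β σ := by
  obtain ⟨-, g, -, -, -, hg⟩ := h
  exact ⟨g, hg⟩

/-- The entries that are not the end of an `r`-related pair form a member of `AvoidsPair r`;
removing them shortens every maximal `r`-chain. -/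
theorem exists_isMerge_avoidsPair {r : ℕ → ℕ → Prop} (hr : IsLtOrGt r) {m : ℕ} {σ : PermOn}
    (hσ : ¬ HasChain r (m + 2) σ) :
    ∃ α ∈ AvoidsPair r, ∃ β, ¬ HasChain r (m + 1) β ∧ IsMerge σ α β := by
  let p : Fin σ.1 → Prop := fun i => ∀ j < i, ¬ r (σ.2 j) (σ.2 i)
  obtain ⟨α, f, hfp, hf⟩ := exists_pattern_on σ p
  obtain ⟨β, g, hgp, hg⟩ := exists_pattern_on σ (fun i => ¬ p i)
  refine ⟨α, ?_, β, ?_, f, g, ?_, ?_, hf, hg⟩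
  · intro u v huv h
    exact (hfp (f v)).mp ⟨v, rfl⟩ (f u) (f.strictMono huv) ((hr.comp_iff hf u v).mp h)
  · rintro ⟨c, hc⟩
    have h0 : ¬ p (g (c 0)) := (hgp _).mp ⟨_, rfl⟩
    simp only [p, not_forall, not_not] at h0
    obtain ⟨j, hj, hrj⟩ := h0
    have hgc (u v : Fin (m + 1)) (huv : u < v) : r (σ.2 (g (c u))) (σ.2 (g (c v))) :=
      (hr.comp_iff hg _ _).mp (hc u v huv)
    let d : Fin (m + 2) → Fin σ.1 := Fin.cons j fun u => g (c u)
    have hle (v : Fin (m + 1)) : g (c 0) ≤ g (c v) := by simp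
    have hd : StrictMono d := by
      intro u v huv
      induction v using Fin.cases with
      | zero => simp at huv
      | succ v =>
        induction u using Fin.cases with
        | zero => simpa [d] using hj.trans_le (hle v)
        | succ u => simpa [d] using huv
    refine hσ ⟨OrderEmbedding.ofStrictMono d hd, ?_⟩
    intro u v huv
    change r (σ.2 (d u)) (σ.2 (d v))
    induction v using Fin.cases with
    | zero => simp at huv
    | succ v =>
      induction u using Fin.cases with
      | zero =>
        simp only [d, Fin.cons_zero, Fin.cons_succ]
        rcases (Fin.zero_le v).eq_or_lt with rfl | hv
        · exact hrj
        · exact hr.trans hrj (hgc 0 v hv)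
      | succ u => simpa [d] using hgc u v (by simpa using huv)
  · intro u v h
    exact (hgp (g v)).mp ⟨v, rfl⟩ ((hfp (g v)).mp ⟨u, h⟩)
  · intro i
    rw [hfp, hgp]
    exact em _

theorem mem_mergeAll_replicate {r : ℕ → ℕ → Prop} (hr : IsLtOrGt r) {C : Set PermOn}
    (hC : IsPermClass C) (m : ℕ) {σ : PermOn} (hσC : σ ∈ C) (hσ : ¬ HasChain r (m + 1) σ) :
    σ ∈ MergeAll (List.replicate m (C ∩ AvoidsPair r)) := by
  induction m generalizing σ with
  | zero =>
    by_contra h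
    have hpos : 0 < σ.1 := Nat.pos_of_ne_zero h
    refine hσ ⟨OrderEmbedding.ofStrictMono (fun _ => ⟨0, hpos⟩) (fun u v huv => ?_),
      fun u v huv => ?_⟩ <;> omega
  | succ m ih =>
    obtain ⟨α, hα, β, hβ, hmerge⟩ := exists_isMerge_avoidsPair hr hσ
    exact ⟨α, ⟨hC σ hσC α hmerge.pattLe_left, hα⟩, β,
      ih (hC σ hσC β hmerge.pattLe_right) hβ, hmerge⟩

theorem isPermClass_avoidsPair {r : ℕ → ℕ → Prop} (hr : IsLtOrGt r) :
    IsPermClass (AvoidsPair r) := by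
  rintro π hπ σ ⟨f, hf⟩ u v huv h
  exact hπ (f u) (f v) (f.strictMono huv) ((hr.comp_iff hf u v).mp h)

theorem AvoidsPair.lt_iff_gt {r : ℕ → ℕ → Prop} {σ : PermOn} (hσ : σ ∈ AvoidsPair r)
    (hr : ∀ a b, r a b ↔ a < b) (u v : Fin σ.1) : σ.2 u < σ.2 v ↔ v < u := by
  have h : StrictAnti σ.2 := by
    intro u v huv
    have h1 := hσ u v huv
    rw [hr] at h1
    exact lt_of_le_of_ne (not_lt.mp h1) fun h => huv.ne' (σ.2.injective h)
  exact h.lt_iff_gt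

theorem AvoidsPair.lt_iff_lt {r : ℕ → ℕ → Prop} {σ : PermOn} (hσ : σ ∈ AvoidsPair r)
    (hr : ∀ a b, r a b ↔ b < a) (u v : Fin σ.1) : σ.2 u < σ.2 v ↔ u < v := by
  have h : StrictMono σ.2 := by
    intro u v huv
    have h1 := hσ u v huv
    rw [hr] at h1
    exact lt_of_le_of_ne (not_lt.mp h1) fun h => huv.ne (σ.2.injective h)
  exact h.lt_iff_lt

theorem pattLe_of_avoidsPair {r : ℕ → ℕ → Prop} (hr : IsLtOrGt r) {σ π : PermOn}
    (hσ : σ ∈ AvoidsPair r) (hπ : π ∈ AvoidsPair r) (h : σ.1 ≤ π.1) : PattLe σ π := by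
  refine ⟨Fin.castLEOrderEmb h, fun u v => ?_⟩
  rcases hr with hr | hr
  · rw [AvoidsPair.lt_iff_gt hσ hr, AvoidsPair.lt_iff_gt hπ hr, OrderEmbedding.lt_iff_lt]
  · rw [AvoidsPair.lt_iff_lt hσ hr, AvoidsPair.lt_iff_lt hπ hr, OrderEmbedding.lt_iff_lt]

theorem finite_setOf_length_lt (n : ℕ) : { σ : PermOn | σ.1 < n }.Finite :=
  ((Finset.range n).sigma fun _ => Finset.univ).finite_toSet.subset fun σ hσ => by
    simpa using hσ

theorem Composable.finite_of_subset_avoidsPair {r : ℕ → ℕ → Prop} (hr : IsLtOrGt r)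
    {C : Set PermOn} (hcomp : Composable C) (hsub : C ⊆ AvoidsPair r) : C.Finite := by
  obtain ⟨_ | ⟨A, l⟩, hne, hAs, hcov⟩ := hcomp
  · exact absurd rfl hne
  obtain ⟨hA, hAC⟩ := hAs A (by simp)
  obtain ⟨σ, hσC, hσA⟩ := Set.exists_of_ssubset hAC
  refine (finite_setOf_length_lt σ.1).subset fun τ hτ => ?_
  obtain ⟨n, α, β, hα, -, rfl⟩ := hcov hτ
  by_contra hn
  exact hσA (hA _ hα σ (pattLe_of_avoidsPair hr (hsub hσC) (hsub (hAC.subset hα)) (not_lt.mp hn)))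

theorem Composable.splittable_of_not_hasChain {r : ℕ → ℕ → Prop} (hr : IsLtOrGt r)
    {C : Set PermOn} (hC : IsPermClass C) (hinf : C.Infinite) (hcomp : Composable C) {m : ℕ}
    (hav : ∀ σ ∈ C, ¬ HasChain r (m + 1) σ) : Splittable C := by
  have hcov : C ⊆ MergeAll (List.replicate m (C ∩ AvoidsPair r)) :=
    fun σ hσ => mem_mergeAll_replicate hr hC m hσ (hav σ hσ)
  refine ⟨_, ?_, ?_, hcov⟩
  · rw [ne_eq, List.replicate_eq_nil_iff]
    rintro rfl
    refine hinf ((finite_setOf_length_lt 1).subset fun σ hσ => ?_)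
    have h0 : σ.1 = 0 := hcov hσ
    simp [h0]
  · intro A hA
    obtain rfl := List.eq_of_mem_replicate hA
    refine ⟨fun π hπ σ hσ => ⟨hC π hπ.1 σ hσ, isPermClass_avoidsPair hr π hπ.2 σ hσ⟩,
      Set.inter_subset_left, fun h => ?_⟩
    exact hinf (hcomp.finite_of_subset_avoidsPair hr fun σ hσ => (h hσ).2)

theorem HasChain.pattLe_iota {k : ℕ} {σ : PermOn} (h : HasChain (· < ·) k σ) :
    PattLe (iota k) σ := by
  obtain ⟨f, hf⟩ := h
  have hmono : StrictMono fun u => σ.2 (f u) := fun u v huv => hf u v huv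
  exact ⟨f, fun u v => hmono.lt_iff_lt.symm⟩

theorem HasChain.pattLe_delta {k : ℕ} {σ : PermOn} (h : HasChain (· > ·) k σ) :
    PattLe (delta k) σ := by
  obtain ⟨f, hf⟩ := h
  have hanti : StrictAnti fun u => σ.2 (f u) := fun u v huv => hf u v huv
  exact ⟨f, fun u v => Fin.rev_lt_rev.trans hanti.lt_iff_gt.symm⟩

/-- An infinite composable permutation class avoiding some
increasing permutation `ι_{m+1}` or some decreasing permutation `δ_{m+1}` is
splittable. -/
theorem stmt_12 (C : Set PermOn) (hC : IsPermClass C) (hinf : C.Infinite)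
    (hcomp : Composable C)
    (hav : (∃ m, ClassAvoids C (iota (m + 1))) ∨
           (∃ m, ClassAvoids C (delta (m + 1)))) :
    Splittable C := by
  rcases hav with ⟨m, hm⟩ | ⟨m, hm⟩
  · exact hcomp.splittable_of_not_hasChain (r := (· < ·)) (Or.inl fun _ _ => Iff.rfl) hC hinf
      fun σ hσ h => hm σ hσ h.pattLe_iota
  · exact hcomp.splittable_of_not_hasChain (r := (· > ·)) (Or.inr fun _ _ => Iff.rfl) hC hinf
      fun σ hσ h => hm σ hσ h.pattLe_delta
end

section
/- Let C be an infinite permutation class avoiding some increasing permutation ι_{m+1}, and suppose C ⊆ A₁ ∘ ⋯ ∘ A_k where each A_i is a subclass of C. Then k must be odd. In particular, an infinite permutation class avoiding an increasing permutation is not 2k-composable for any k ≥ 1. -/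
theorem pattLe_iota_of_strictMonoOn {σ : PermOn} {k : ℕ} (S : Finset (Fin σ.1))
    (hS : StrictMonoOn σ.2 (S : Set (Fin σ.1))) (hk : k ≤ S.card) : PattLe (iota k) σ := by
  refine ⟨S.orderEmbOfCardLe hk, fun (u v : Fin k) => ?_⟩
  exact ((hS.lt_iff_lt (S.orderEmbOfCardLe_mem hk u) (S.orderEmbOfCardLe_mem hk v)).trans
    (S.orderEmbOfCardLe hk).lt_iff_lt).symm

/-- If the strictly increasing subsequences of `f` have length at most `m`, the indices can be
coloured with `m + 1` colours so that `f` is decreasing on each colour. -/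
theorem exists_coloring_antitone {n m : ℕ} (f : Equiv.Perm (Fin n))
    (hf : ∀ S : Finset (Fin n), StrictMonoOn f (S : Set (Fin n)) → S.card ≤ m) :
    ∃ c : Fin n → Fin (m + 1), ∀ i j, i < j → c i = c j → f j < f i := by
  classical
  let chains (i : Fin n) : Finset (Finset (Fin n)) :=
    {S | StrictMonoOn f (S : Set (Fin n)) ∧ i ∈ S ∧ ∀ j ∈ S, j ≤ i}
  have hne (i : Fin n) : (chains i).Nonempty := ⟨{i}, by simp [chains]⟩
  have hle (i : Fin n) : (chains i).sup Finset.card ≤ m :=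
    Finset.sup_le fun S hS => hf S (Finset.mem_filter.1 hS).2.1
  refine ⟨fun i => ⟨(chains i).sup Finset.card, Nat.lt_succ_of_le (hle i)⟩, ?_⟩
  intro i j hij hc
  by_contra hlt
  have hfij : f i < f j := lt_of_le_of_ne (not_lt.1 hlt) (f.injective.ne hij.ne)
  obtain ⟨S, hS, hmax⟩ := Finset.exists_mem_eq_sup (chains i) (hne i) Finset.card
  obtain ⟨-, hmono, hi, hlast⟩ := Finset.mem_filter.1 hS
  have hjS : j ∉ S := fun h => (hlast j h).not_gt hij
  have hins : insert j S ∈ chains j := by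
    refine Finset.mem_filter.2 ⟨Finset.mem_univ _, ?_, Finset.mem_insert_self _ _, ?_⟩
    · intro a ha b hb hab
      rcases Finset.mem_insert.1 (Finset.mem_coe.1 ha) with rfl | haS <;>
        rcases Finset.mem_insert.1 (Finset.mem_coe.1 hb) with rfl | hbS
      · exact absurd hab (lt_irrefl _)
      · exact absurd (hab.trans_le (hlast b hbS)) hij.asymm
      · exact (hmono.monotoneOn haS hi (hlast a haS)).trans_lt hfij
      · exact hmono haS hbS hab
    · intro a ha
      rcases Finset.mem_insert.1 ha with rfl | ha
      · exact le_rfl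
      · exact (hlast a ha).trans hij.le
  have hcard := Finset.le_sup (f := Finset.card) hins
  rw [Finset.card_insert_of_notMem hjS, ← hmax] at hcard
  have := Fin.val_eq_of_eq hc
  simp only at this
  omega

/-- A composition of `k` permutations avoiding `ι_{m+1}` is monotone on each colour of some
colouring with `(m + 1) ^ k` colours: increasing if `k` is even, decreasing if `k` is odd. -/
theorem exists_coloring_of_mem_compAll {m : ℕ} (l : List (Set PermOn))
    (hl : ∀ A ∈ l, ClassAvoids A (iota (m + 1))) (σ : PermOn) (hσ : σ ∈ CompAll l) :
    ∃ c : Fin σ.1 → Fin ((m + 1) ^ l.length), ∀ i j, i < j → c i = c j →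
      if Even l.length then σ.2 i < σ.2 j else σ.2 j < σ.2 i := by
  induction l generalizing σ with
  | nil =>
    have h1 : σ.2 = 1 := hσ
    exact ⟨fun _ => ⟨0, by simp⟩, fun i j hij _ => by simpa [h1] using hij⟩
  | cons A l ih =>
    obtain ⟨n, α, β, hα, hβ, rfl⟩ := hσ
    obtain ⟨c, hc⟩ := ih (fun B hB => hl B (List.mem_cons_of_mem _ hB)) ⟨n, β⟩ hβ
    obtain ⟨d, hd⟩ := exists_coloring_antitone (m := m) α fun S hS => by
      by_contra! h
      exact hl A List.mem_cons_self _ hα (pattLe_iota_of_strictMonoOn (σ := ⟨n, α⟩) S hS h)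
    refine ⟨fun i => Fin.cast (pow_succ _ _).symm (finProdFinEquiv (c i, d (β i))), ?_⟩
    intro i j hij h
    have h := finProdFinEquiv.injective (Fin.cast_injective _ h)
    obtain ⟨h1, h2⟩ := Prod.mk.inj h
    have hβij := hc i j hij h1
    by_cases he : Even l.length
    · simp only [he, if_true] at hβij
      simpa [Nat.even_add_one, he] using hd _ _ hβij h2
    · simp only [he, if_false] at hβij
      simpa [Nat.even_add_one, he] using hd _ _ hβij h2.symm

theorem finite_setOf_length_le (N : ℕ) : {σ : PermOn | σ.1 ≤ N}.Finite := by
  refine (Set.finite_range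
    (fun x : Σ n : Fin (N + 1), Equiv.Perm (Fin n) => (⟨x.1, x.2⟩ : PermOn))).subset ?_
  rintro ⟨n, f⟩ hn
  exact ⟨⟨⟨n, Nat.lt_succ_of_le hn⟩, f⟩, rfl⟩

/-- If an infinite permutation class `C` avoiding an increasing
permutation `ι_{m+1}` satisfies `C ⊆ A₁ ∘ ⋯ ∘ A_k` with each `A_i` a subclass
of `C`, then `k` is odd; in particular such a class is not `2k`-composable. -/
theorem stmt_13 (C : Set PermOn) (hC : IsPermClass C) (hinf : C.Infinite)
    (m : ℕ) (hav : ClassAvoids C (iota (m + 1)))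
    (As : List (Set PermOn)) (hne : As ≠ [])
    (hsub : ∀ A ∈ As, IsPermClass A ∧ A ⊆ C)
    (hcomp : C ⊆ CompAll As) :
    Odd As.length := by
  classical
  by_contra hodd
  have heven : Even As.length := Nat.not_odd_iff_even.1 hodd
  refine hinf ((finite_setOf_length_le (m * (m + 1) ^ As.length)).subset fun σ hσ => ?_)
  obtain ⟨c, hc⟩ := exists_coloring_of_mem_compAll As
    (fun A hA τ hτ => hav τ ((hsub A hA).2 hτ)) σ (hcomp hσ)
  have hfiber (b : Fin ((m + 1) ^ As.length)) :
      (Finset.univ.filter fun i => c i = b).card ≤ m := by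
    by_contra! h
    refine hav σ hσ (pattLe_iota_of_strictMonoOn _ (fun i hi j hj hij => ?_) h)
    have hi : c i = b := by simpa using hi
    have hj : c j = b := by simpa using hj
    simpa only [heven, if_true] using hc i j hij (hi.trans hj.symm)
  simpa using Finset.card_le_mul_card_image_of_maps_to
    (s := Finset.univ) (t := Finset.univ) (f := c) (fun _ _ => Finset.mem_univ _) m
    fun b _ => hfiber b
end
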